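/- For every integer m ≥ 1 and every real number κ < m+1, there are infinitely many pairs of integers (p,q) with q > 0 such that 0 < |ε_m − p/q| < 1/q^κ; in particular, the irrationality measure of ε_m is at least m+1 (hence ε_1 is irrational, and by Roth's theorem ε_m is transcendental for m ≥ 2). -/

import Mathlib

open List Filter

open scoped Classical

noncomputable section

/-- The curling number of a finite string: the largest `k` such that
`S = X ++ Y^k` with `Y` nonempty; by convention `curl [] = 1`. -/
def curl (S : List ℕ) : ℕ :=
  max 1 (sSup {k | ∃ X Y : List ℕ, Y ≠ [] ∧ S = X ++ (List.replicate k Y).flatten})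

/-- The prefix of length `n` of the level-`m` Gijswijt sequence `A^(m)`. -/
def gPrefix (m : ℕ) : ℕ → List ℕ
  | 0 => []
  | n + 1 => gPrefix m n ++ [max m (curl (gPrefix m n))]

/-- `gij m p` is the `p`-th term (1-indexed) of the level-`m` Gijswijt sequence `A^(m)`. -/
def gij (m p : ℕ) : ℕ := max m (curl (gPrefix m (p - 1)))

/-- Standing hypothesis: for every `m ≥ 1`, the sets
`{k ≥ 0 : C(A^(m)[1,k]) ≤ m}` and `{k ≥ 0 : C(A^(m+1)[1,k]) ≤ m}` are infinite. -/
def StandingHyp : Prop :=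
  ∀ m : ℕ, 1 ≤ m →
    {k : ℕ | curl (gPrefix m k) ≤ m}.Infinite ∧
    {k : ℕ | curl (gPrefix (m + 1) k) ≤ m}.Infinite

/-- Length of `π^(m)(1,x)`: the `x`-th smallest (0-indexed) element of
`{k : C(A^(m)[1,k]) ≤ m}`. -/
def piLen (m x : ℕ) : ℕ := Nat.nth (fun k => curl (gPrefix m k) ≤ m) x

/-- `π^(m)(1,x)`: the prefix of `A^(m)` with exactly `x` occurrences of `m`
and curling number at most `m`. -/
def piStr (m x : ℕ) : List ℕ := gPrefix m (piLen m x)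

/-- `β^(m)(t)`, the length of `B_t^(m)`. -/
def beta (m t : ℕ) : ℕ := piLen m ((m + 1) ^ (t - 1))

/-- `B_t^(m) := π^(m)(1,(m+1)^(t-1))`. -/
def Bstr (m t : ℕ) : List ℕ := piStr m ((m + 1) ^ (t - 1))

/-- `τ^(m)(t)`, the length of `T_t^(m)`. -/
def tau (m t : ℕ) : ℕ := Nat.nth (fun k => curl (gPrefix (m + 1) k) ≤ m) (t - 1)

/-- `T_t^(m)`: the `t`-th shortest prefix of `A^(m+1)` with curling number at most `m`. -/
def Tstr (m t : ℕ) : List ℕ := gPrefix (m + 1) (tau m t)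

/-- `φ^(m)(n)`: the least `p ≥ 1` with `A^(m)(p) = n`. -/
def phi (m n : ℕ) : ℕ := sInf {p : ℕ | 1 ≤ p ∧ gij m p = n}

/-- `t^(m)(n) = 1 + log_{m+1} #\{i ≤ φ^(m)(n) : A^(m)(i) = m\}`. -/
def tfun (m n : ℕ) : ℕ := 1 + Nat.log (m + 1) ((gPrefix m (phi m n)).count m)

/-- `χ^(b)(a)`: read the base-`b` digits of `a` as base-`(b+1)` digits. -/
def chi (b a : ℕ) : ℕ := Nat.ofDigits (b + 1) (Nat.digits b a)

/-- `ι_m(t)`: read the base-`(m+2)` digits of the number of occurrences of `m+1`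
in `T_t^(m)` as base-`(m+1)` digits. -/
def iota (m t : ℕ) : ℕ :=
  Nat.ofDigits (m + 1) (Nat.digits (m + 2) ((Tstr m t).count (m + 1)))

/-- `ι_m⁻¹(p)`: the largest `x ≥ 1` with `ι_m(x) ≤ p`. -/
def iotaInv (m p : ℕ) : ℕ := sSup {x : ℕ | 1 ≤ x ∧ iota m x ≤ p}

/-- `ord_b(n)`: the `b`-adic valuation of `n`. -/
def ordb (b n : ℕ) : ℕ := sSup {z : ℕ | b ^ z ∣ n}

/-- The largest base-`b` digit of `n`. -/
def maxdigit (b n : ℕ) : ℕ := (Nat.digits b n).foldr max 0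

/-- Auxiliary function for the level-`m` expansion: `lexpAux m a k = a_{m+1+k}`. -/
def lexpAux (m a : ℕ) : ℕ → ℕ
  | 0 => a
  | k + 1 => iota (m + 1 + k) (ordb (m + 1 + k) (lexpAux m a k) + 1)

/-- `lexp m a l = a_l`, the `l`-th term of the level-`m` expansion of `a`. -/
def lexp (m a l : ℕ) : ℕ := lexpAux m a (l - (m + 1))

/-- The last element `n` of `π^(m+1)(1, χ^(m+1)(a))`; the level-`m` expansion
of `a` is `a_{m+1}, …, a_n`. -/
def levelEnd (m a : ℕ) : ℕ := (piStr (m + 1) (chi (m + 1) a)).getLastD 0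

/-- `V_m := {v ≥ 0 : C(T_{v+1}^(m+1)) ≤ m}`. -/
def Vset (m : ℕ) : Set ℕ := {v | curl (Tstr (m + 1) (v + 1)) ≤ m}

/-- `Q := {α ≥ 0 : C(T_{α+1}^(2)) = 1}`. -/
def Qset : Set ℕ := {a | curl (Tstr 2 (a + 1)) = 1}

/-- `R := {(a,b) : a ∈ Q, a < b, no suffix S of T_{a+1}^(2) with T_{a+1}^(2)·S = T_{b+1}^(2)}`. -/
def Rset : Set (ℕ × ℕ) :=
  {p | p.1 ∈ Qset ∧ p.1 < p.2 ∧
    ¬∃ S : List ℕ, S <:+ Tstr 2 (p.1 + 1) ∧ Tstr 2 (p.1 + 1) ++ S = Tstr 2 (p.2 + 1)}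

/-- The digit of `x` in base `b` at (1-indexed) position `i`, i.e. the coefficient
of `b^(i-1)`. -/
def digitAt (b x i : ℕ) : ℕ := (Nat.digits b x).getD (i - 1) 0

/-- `u` is the (1-indexed) position of the second nonzero base-`b` digit of `x`
(the first nonzero digit being at position `ord_b(x)+1`). -/
def IsSecondNonzero (b x u : ℕ) : Prop :=
  ordb b x + 1 < u ∧ digitAt b x u ≠ 0 ∧
    ∀ i, ordb b x + 1 < i → i < u → digitAt b x i = 0

/-- `𝒮_b`: pairs `(a,a')` with `1 ≤ a < a'` such that for some position `y` the
base-`b` digits of `a` and `a'` agree away from `y` and twice the `y`-th digit of `a`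
is at least the `y`-th digit of `a'`. -/
def Sset (b : ℕ) : Set (ℕ × ℕ) :=
  {p | 1 ≤ p.1 ∧ p.1 < p.2 ∧
    ∃ y : ℕ, (∀ i, i ≠ y → (Nat.digits b p.1).getD i 0 = (Nat.digits b p.2).getD i 0) ∧
      (Nat.digits b p.2).getD y 0 ≤ 2 * (Nat.digits b p.1).getD y 0}

/-- The glue string `S_t^(m)`, so that `T_{t+1}^(m) = T_t^(m) ++ glue m t`. -/
def glue (m t : ℕ) : List ℕ := (gPrefix (m + 1) (tau m (t + 1))).drop (tau m t)

/-- The strings `P_t^(m)`: `P_1^(m) = (m)` and `P_{t+1}^(m) = P_t^(m)·B_t^(m)·S_t^(m)`. -/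
def Pstr (m : ℕ) : ℕ → List ℕ
  | 0 => []
  | 1 => [m]
  | t + 2 => Pstr m (t + 1) ++ Bstr m (t + 1) ++ glue m (t + 1)

end

/-- The letter of `A^(m)` at the 0-indexed position `n`. -/
noncomputable def letter (m n : ℕ) : ℕ := max m (curl (gPrefix m n))

/-- The prefix of length `n` of the word `w` ends with a `k`-th power of a block of length `p`. -/
def EndsPow (w : ℕ → ℕ) (n k p : ℕ) : Prop :=
  0 < p ∧ k * p ≤ n ∧ ∀ i, n ≤ i + k * p → i + p < n → w i = w (i + p)

theorem gPrefix_eq_map_range (m n : ℕ) : gPrefix m n = (List.range n).map (letter m) := by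
  induction n with
  | zero => rfl
  | succ n ih => rw [gPrefix, List.range_succ, List.map_append, ← ih]; rfl

theorem getElem_flatten_replicate (Y : List ℕ) (k i : ℕ)
    (h : i < (List.replicate k Y).flatten.length) (h' : i % Y.length < Y.length) :
    (List.replicate k Y).flatten[i] = Y[i % Y.length] := by
  induction k generalizing i with
  | zero => simp at h
  | succ k ih =>
    simp only [List.replicate_succ, List.flatten_cons, List.getElem_append]
    split_ifs with hi
    · simp [Nat.mod_eq_of_lt hi]
    · push Not at hi
      rw [ih]
      · simp only [← Nat.mod_eq_sub_mod hi]
      · rwa [← Nat.mod_eq_sub_mod hi]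

theorem EndsPow.anti {w : ℕ → ℕ} {n k k' p : ℕ} (h : EndsPow w n k p) (hk : k' ≤ k) :
    EndsPow w n k' p := by
  obtain ⟨h1, h2, h3⟩ := h
  have := Nat.mul_le_mul_right p hk
  exact ⟨h1, by omega, fun i hi hi' => h3 i (by omega) hi'⟩

theorem EndsPow.apply_add_mul {w : ℕ → ℕ} {n k p : ℕ} (h : EndsPow w n k p) (i r : ℕ)
    (hi : n ≤ i + k * p) (hr : i + r * p < n) : w (i + r * p) = w i := by
  induction r with
  | zero => simp
  | succ r ih =>
    rw [Nat.succ_mul] at hr ⊢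
    rw [← ih (by omega), ← add_assoc]
    exact (h.2.2 _ (by omega) (by omega)).symm

theorem exists_append_iff_endsPow (w : ℕ → ℕ) (n k : ℕ) :
    (∃ X Y : List ℕ, Y ≠ [] ∧
      (List.range n).map w = X ++ (List.replicate k Y).flatten) ↔ ∃ p, EndsPow w n k p := by
  constructor
  · rintro ⟨X, Y, hY, h⟩
    have hp : 0 < Y.length := List.length_pos_iff.2 hY
    have hlen : n = X.length + k * Y.length := by
      have := congrArg List.length h
      simpa using this
    refine ⟨Y.length, hp, by omega, fun i hi hi' => ?_⟩
    have key : ∀ j, n ≤ j + k * Y.length → ∀ hj : j < n,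
        w j = Y[(j - X.length) % Y.length]'(Nat.mod_lt _ hp) := by
      intro j hj1 hj2
      have e : w j = ((List.range n).map w)[j]'(by simpa using hj2) := by simp
      rw [e]
      simp only [h]
      rw [List.getElem_append_right (by omega), getElem_flatten_replicate]
    rw [key i hi (by omega), key (i + Y.length) (by omega) hi']
    congr 1
    rw [show i + Y.length - X.length = (i - X.length) + Y.length by omega]
    simp
  · rintro ⟨p, hp, hkp, h⟩
    have hw : EndsPow w n k p := ⟨hp, hkp, h⟩
    rcases Nat.eq_zero_or_pos k with rfl | hk
    · exact ⟨(List.range n).map w, [0], by simp, by simp⟩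
    have hpk : p ≤ k * p := Nat.le_mul_of_pos_left p hk
    refine ⟨(List.range (n - k * p)).map w,
      (List.range p).map fun i => w (n - k * p + i), by simp; omega, ?_⟩
    apply List.ext_getElem
    · simp; omega
    · intro i h1 h2
      simp only [List.length_map, List.length_range] at h1
      rcases lt_or_ge i (n - k * p) with hi | hi
      · rw [List.getElem_append_left (by simpa using hi)]; simp
      · rw [List.getElem_append_right (by simpa using hi), getElem_flatten_replicate _ _ _ _
          (Nat.mod_lt _ (by simpa using hp))]
        simp only [List.getElem_map, List.getElem_range, List.length_map, List.length_range]
        have := Nat.mod_add_div (i - (n - k * p)) p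
        have e : i = n - k * p + (i - (n - k * p)) % p + (i - (n - k * p)) / p * p := by
          rw [mul_comm p] at this; omega
        conv_lhs => rw [e]
        exact hw.apply_add_mul _ _ (by omega) (by omega)

theorem le_curl_iff (m n k : ℕ) (hk : 2 ≤ k) :
    k ≤ curl (gPrefix m n) ↔ ∃ p, EndsPow (letter m) n k p := by
  have hs : {k | ∃ X Y : List ℕ, Y ≠ [] ∧
      gPrefix m n = X ++ (List.replicate k Y).flatten} = {k | ∃ p, EndsPow (letter m) n k p} := by
    ext k
    rw [gPrefix_eq_map_range]
    exact exists_append_iff_endsPow _ _ _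
  have hb : BddAbove {k | ∃ p, EndsPow (letter m) n k p} := by
    refine ⟨n, ?_⟩
    rintro k ⟨p, hp, h, -⟩
    nlinarith
  rw [curl, hs, le_max_iff]
  constructor
  · rintro (h | h)
    · omega
    · obtain ⟨p, hp⟩ := Nat.sSup_mem (s := {k | ∃ p, EndsPow (letter m) n k p})
        ⟨0, 1, by simp [EndsPow]; omega⟩ hb
      exact ⟨p, hp.anti h⟩
  · intro h
    exact Or.inr (le_csSup hb h)

theorem one_le_curl (S : List ℕ) : 1 ≤ curl S := le_max_left _ _

theorem curl_gPrefix_le (m n : ℕ) (hn : 1 ≤ n) : curl (gPrefix m n) ≤ n := by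
  by_contra! h
  obtain ⟨p, hp, h1, -⟩ := (le_curl_iff m n (n + 1) (by omega)).1 h
  nlinarith

theorem curl_gPrefix_zero (m : ℕ) : curl (gPrefix m 0) = 1 := by
  refine le_antisymm ?_ (one_le_curl _)
  by_contra! h
  obtain ⟨p, hp, h1, -⟩ := (le_curl_iff m 0 2 le_rfl).1 h
  omega

theorem letter_zero (m : ℕ) (hm : 1 ≤ m) : letter m 0 = m := by
  rw [letter, curl_gPrefix_zero]; omega

/-- The position of the marker following `x` markers, in a word in which the `i`-th marker
is followed by a gap of length `L i`. -/
def markerPos (L : ℕ → ℕ) (x : ℕ) : ℕ := ∑ i ∈ Finset.range x, (1 + L (i + 1))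

theorem markerPos_succ (L : ℕ → ℕ) (x : ℕ) :
    markerPos L (x + 1) = markerPos L x + 1 + L (x + 1) := by
  rw [markerPos, Finset.sum_range_succ, ← markerPos, add_assoc]

@[simp] theorem markerPos_zero (L : ℕ → ℕ) : markerPos L 0 = 0 := rfl

theorem markerPos_strictMono (L : ℕ → ℕ) : StrictMono (markerPos L) :=
  strictMono_nat_of_lt_succ fun x => by rw [markerPos_succ]; omega

theorem exists_markerPos_le (L : ℕ → ℕ) (n : ℕ) :
    ∃ x, markerPos L x ≤ n ∧ n < markerPos L (x + 1) := by
  induction n with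
  | zero => exact ⟨0, by simp, by rw [markerPos_succ]; omega⟩
  | succ n ih =>
    obtain ⟨x, h1, h2⟩ := ih
    rcases lt_or_ge (n + 1) (markerPos L (x + 1)) with h | h
    · exact ⟨x, by omega, h⟩
    · exact ⟨x + 1, h, by rw [markerPos_succ]; omega⟩

/-- The prefix of length `n` of `w` consists of letters `m`, the `i`-th of them being followed by
the prefix of length `L i` of the word `v`, which avoids `m`. -/
structure Gapped (m : ℕ) (w v L : ℕ → ℕ) (n : ℕ) : Prop where
  ne : ∀ i, v i ≠ m
  marker : ∀ x, markerPos L x < n → w (markerPos L x) = m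
  gap : ∀ x g, g < L (x + 1) → markerPos L x + 1 + g < n → w (markerPos L x + 1 + g) = v g

/-- A `k`-th power of block length `p`, ending the prefix that stops `g` letters after the marker
`x`, covers `k * y` markers, and shifts the markers it covers by `y`. -/
structure GapShift (L : ℕ → ℕ) (x g k p y : ℕ) : Prop where
  pos : 1 ≤ y
  mul_le : k * y ≤ x + 1
  le : y ≤ x
  last : markerPos L (x - y) + p = markerPos L x
  shift : ∀ i, markerPos L x + 1 + g ≤ markerPos L i + k * p → i + y ≤ x →
    markerPos L (i + y) = markerPos L i + p
  window : ∀ i, markerPos L x + 1 + g ≤ markerPos L i + k * p ↔ x + 1 ≤ i + k * y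
  gap_le : g ≤ L (x - y + 1)

theorem GapShift.gap_eq {L : ℕ → ℕ} {x g k p y i : ℕ} (h : GapShift L x g k p y)
    (h1 : x + 1 < i + k * y) (h2 : i + y < x + 1) (h0 : 0 < i) : L (i + y) = L i := by
  obtain ⟨i, rfl⟩ : ∃ j, i = j + 1 := ⟨i - 1, by omega⟩
  have e1 := h.shift i ((h.window i).2 (by omega)) (by omega)
  have e2 := h.shift (i + 1) ((h.window _).2 (by omega)) (by omega)
  rw [show i + 1 + y = i + y + 1 by omega] at e2 ⊢
  rw [markerPos_succ, markerPos_succ] at e2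
  omega

theorem GapShift.iterate {L : ℕ → ℕ} {x g k p y i : ℕ} (h : GapShift L x g k p y) (r : ℕ)
    (h1 : x + 1 ≤ i + k * y) (h2 : i + r * y ≤ x) :
    markerPos L (i + r * y) = markerPos L i + r * p := by
  induction r with
  | zero => simp
  | succ r ih =>
    rw [Nat.succ_mul] at h2 ⊢
    rw [Nat.succ_mul, ← add_assoc, h.shift _ ((h.window _).2 (by omega)) (by omega),
      ih (by omega), add_assoc]

namespace Gapped

variable {m : ℕ} {w v L : ℕ → ℕ} {n : ℕ}

theorem eq_markerPos (h : Gapped m w v L n) {z : ℕ} (hz : z < n) (hw : w z = m) :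
    ∃ x, z = markerPos L x := by
  obtain ⟨x, h1, h2⟩ := exists_markerPos_le L z
  refine ⟨x, ?_⟩
  by_contra hne
  rw [markerPos_succ] at h2
  have := h.gap x (z - markerPos L x - 1) (by omega) (by omega)
  rw [show markerPos L x + 1 + (z - markerPos L x - 1) = z by omega] at this
  exact h.ne _ (this ▸ hw)

theorem ne_marker (h : Gapped m w v L n) {x g : ℕ} (hg : g < L (x + 1))
    (hn : markerPos L x + 1 + g < n) : w (markerPos L x + 1 + g) ≠ m := by
  rw [h.gap x g hg hn]; exact h.ne g

/-- A power reaching beyond the last gap is a power of the sequence of gaps. -/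
theorem exists_shift {x g k p : ℕ} (h : Gapped m w v L (markerPos L x + 1 + g))
    (hg : g ≤ L (x + 1)) (hk : 2 ≤ k) (hp : EndsPow w (markerPos L x + 1 + g) k p)
    (hkp : g < k * p) :
    ∃ y, GapShift L x g k p y := by
  set n := markerPos L x + 1 + g with hn
  have mono := markerPos_strictMono L
  obtain ⟨hp0, hkn, hper⟩ := id hp
  have h2p : 2 * p ≤ k * p := Nat.mul_le_mul_right p hk
  have hgp : g < p := by
    by_contra! hpg
    have e := hper (markerPos L x) (by omega) (by omega)
    rw [h.marker x (by omega)] at e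
    have := h.ne_marker (x := x) (g := p - 1) (by omega) (by omega)
    rw [show markerPos L x + 1 + (p - 1) = markerPos L x + p by omega] at this
    exact this e.symm
  have down : ∀ i, n ≤ markerPos L i + k * p → markerPos L i + p < n →
      ∃ i', markerPos L i + p = markerPos L i' := by
    intro i h1 h2
    apply h.eq_markerPos h2
    rw [← hper _ h1 h2]
    exact h.marker i (by omega)
  have up : ∀ i, n + p ≤ markerPos L i + k * p → p ≤ markerPos L i → markerPos L i < n →
      ∃ i', markerPos L i' + p = markerPos L i := by
    intro i h1 h2 h3
    obtain ⟨i', hi'⟩ := h.eq_markerPos (z := markerPos L i - p) (by omega) (by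
      rw [hper _ (by omega) (by omega), show markerPos L i - p + p = markerPos L i by omega]
      exact h.marker i h3)
    exact ⟨i', by omega⟩
  obtain ⟨x', hx'⟩ := up x (by omega) (by omega) (by omega)
  have hlt : x' < x := mono.lt_iff_lt.1 (by omega)
  obtain ⟨y, hy, rfl⟩ : ∃ y, 1 ≤ y ∧ x = x' + y := ⟨x - x', by omega, by omega⟩
  have shift : ∀ d, ∀ i, i + d = x' → n ≤ markerPos L i + k * p →
      markerPos L (i + y) = markerPos L i + p := by
    intro d
    induction d with
    | zero => rintro i rfl _; exact hx'.symm
    | succ d ih =>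
      intro i hi hin
      have l1 := mono (Nat.lt_succ_self i)
      have l2 := mono (Nat.lt_succ_self (i + y))
      have e1 := ih (i + 1) (by omega) (by simp only [Nat.succ_eq_add_one] at l1; omega)
      simp only [Nat.succ_eq_add_one] at l1 l2
      rw [show i + 1 + y = i + y + 1 by omega] at e1
      have l3 : markerPos L (i + y + 1) ≤ markerPos L (x' + y) := mono.monotone (by omega)
      obtain ⟨i', hi'⟩ := down i hin (by omega)
      rw [hi']
      have a1 : i' < i + y + 1 := mono.lt_iff_lt.1 (by omega)
      rcases Nat.lt_or_ge i' (i + y) with a2 | a2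
      · exfalso
        have a3 := mono a2
        obtain ⟨j, hj⟩ := up (i + y) (by omega) (by omega) (by omega)
        have b1 : i < j := mono.lt_iff_lt.1 (by omega)
        have b2 : j < i + 1 := mono.lt_iff_lt.1 (by omega)
        omega
      · congr 1; omega
  have shift' : ∀ i, n ≤ markerPos L i + k * p → i + y ≤ x' + y →
      markerPos L (i + y) = markerPos L i + p :=
    fun i hi hi' => shift (x' - i) i (by omega) hi
  have gle : g ≤ L (x' + 1) := by
    by_contra! hgl
    have l1 := markerPos_succ L x'
    have l2 : markerPos L (x' + 1) ≤ markerPos L (x' + y) := mono.monotone (by omega)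
    have e := hper (markerPos L (x' + 1)) (by omega) (by omega)
    rw [h.marker _ (by omega), show markerPos L (x' + 1) + p =
      markerPos L (x' + y) + 1 + L (x' + 1) by omega] at e
    exact h.ne_marker (by omega) (by omega) e.symm
  have sub : ∀ i, i ≤ x' + y → n + p ≤ markerPos L i + k * p → p ≤ markerPos L i →
      y ≤ i ∧ markerPos L (i - y) + p = markerPos L i := by
    intro i hi h1 h2
    have l1 : markerPos L i ≤ markerPos L (x' + y) := mono.monotone hi
    obtain ⟨j, hj⟩ := up i h1 h2 (by omega)
    have l2 : j ≤ x' := mono.le_iff_le.1 (by omega)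
    have e := shift' j (by omega) (by omega)
    have e2 : j + y = i := mono.injective (by omega)
    exact ⟨by omega, by rw [← hj, show i - y = j by omega]⟩
  have first : ∀ r, r + 1 ≤ k → (r + 1) * y ≤ x' + y + 1 ∧
      n ≤ markerPos L (x' + y + 1 - (r + 1) * y) + (r + 1) * p := by
    intro r
    induction r with
    | zero =>
      intro _
      have l1 := markerPos_succ L x'
      rw [zero_add, one_mul, one_mul, show x' + y + 1 - y = x' + 1 by omega]
      omega
    | succ r ih =>
      intro hr
      obtain ⟨i1, i2⟩ := ih (by omega)
      have l1 := Nat.mul_le_mul_right p hr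
      have : 1 * y ≤ (r + 1) * y := Nat.mul_le_mul_right y (by omega)
      rw [Nat.succ_mul (r + 1)] at l1 ⊢
      obtain ⟨s1, s2⟩ := sub (x' + y + 1 - (r + 1) * y) (by omega) (by omega) (by omega)
      rw [Nat.succ_mul (r + 1), ← Nat.sub_sub]
      omega
  obtain ⟨f1, f2⟩ := first (k - 1) (by omega)
  rw [show k - 1 + 1 = k by omega] at f1 f2
  have iter : ∀ r i, n ≤ markerPos L i + k * p → i + r * y ≤ x' + y →
      markerPos L (i + r * y) = markerPos L i + r * p := by
    intro r
    induction r with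
    | zero => simp
    | succ r ih =>
      intro i h1 h2
      rw [Nat.succ_mul] at h2 ⊢
      rw [Nat.succ_mul, ← add_assoc, shift' _ (by rw [ih i h1 (by omega)]; omega) (by omega),
        ih i h1 (by omega), add_assoc]
  refine ⟨y, hy, by simpa using f1, by omega, by simpa using hx', shift',
    fun i => ⟨fun hi => ?_, fun hi => ?_⟩, by simpa using gle⟩
  · by_contra! hc
    have l0 : markerPos L i ≤ markerPos L (x' + y - k * y) := mono.monotone (by omega)
    have := iter k (x' + y - k * y) (by omega) (by omega)
    rw [show x' + y - k * y + k * y = x' + y by omega] at this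
    omega
  · have : markerPos L (x' + y + 1 - k * y) ≤ markerPos L i := mono.monotone (by omega)
    omega

/-- A square whose second half starts inside a longer gap forces that gap to end in a square. -/
theorem square_gap {x g p y : ℕ} (h : Gapped m w v L (markerPos L x + 1 + g))
    (hp : EndsPow w (markerPos L x + 1 + g) 2 p) (hy : GapShift L x g 2 p y)
    (hxy : 2 * y < x + 1) (hL : L (x + 1 - 2 * y) = g) (hlt : g < L (x + 1 - y)) :
    L (x + 1 - y) ≤ 2 * g ∧ EndsPow v (L (x + 1 - y)) 2 (L (x + 1 - y) - g) := by
  obtain ⟨z, rfl⟩ : ∃ z, x = z + 2 * y := ⟨x - 2 * y, by omega⟩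
  have hy1 := hy.pos
  have e0 := hy.last
  have e1 := hy.shift (z + 1) ((hy.window _).2 (by omega)) (by omega)
  have e2 := mt (hy.window z).1 (by omega)
  rw [show z + 2 * y + 1 - 2 * y = z + 1 by omega] at hL
  rw [show z + 2 * y + 1 - y = z + y + 1 by omega] at hlt ⊢
  rw [show z + 2 * y - y = z + y by omega] at e0
  rw [show z + 1 + y = z + y + 1 by omega] at e1
  have l1 := markerPos_succ L z
  have l2 := markerPos_succ L (z + y)
  have hle : markerPos L (z + y + 1) ≤ markerPos L (z + 2 * y) :=
    (markerPos_strictMono L).monotone (by omega)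
  refine ⟨by omega, by omega, by omega, fun i hi hi' => ?_⟩
  have f1 := h.gap z i (by omega) (by omega)
  have f2 := h.gap (z + y) (i + (L (z + y + 1) - g)) (by omega) (by omega)
  rw [← f1, ← f2, hp.2.2 _ (by omega) (by omega)]
  congr 1
  omega

theorem endsPow_iff {x g k p : ℕ} (h : Gapped m w v L (markerPos L x + 1 + g))
    (hg : g ≤ L (x + 1)) (hkp : k * p ≤ g) :
    EndsPow w (markerPos L x + 1 + g) k p ↔ EndsPow v g k p := by
  constructor
  · rintro ⟨h1, h2, h3⟩
    refine ⟨h1, hkp, fun i hi hi' => ?_⟩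
    rw [← h.gap x i (by omega) (by omega), ← h.gap x (i + p) (by omega) (by omega),
      h3 _ (by omega) (by omega), add_assoc]
  · rintro ⟨h1, h2, h3⟩
    refine ⟨h1, by omega, fun i hi hi' => ?_⟩
    obtain ⟨j, rfl⟩ : ∃ j, i = markerPos L x + 1 + j := ⟨i - (markerPos L x + 1), by omega⟩
    rw [add_assoc _ j, h.gap x j (by omega) (by omega), h.gap x (j + p) (by omega) (by omega)]
    exact h3 _ (by omega) (by omega)

end Gapped

/-- The lengths of the prefixes of `A^(m+1)` with curling number at most `m`. -/
noncomputable def cutPos (m r : ℕ) : ℕ := Nat.nth (fun k => curl (gPrefix (m + 1) k) ≤ m) r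

/-- The length of the gap following the `i`-th `m` in `A^(m)`. -/
noncomputable def gapLen (m i : ℕ) : ℕ := cutPos m (multiplicity (m + 1) i)

theorem pow_dvd_iff_le_mult {m i : ℕ} (hm : 1 ≤ m) (hi : 0 < i) (e : ℕ) :
    (m + 1) ^ e ∣ i ↔ e ≤ multiplicity (m + 1) i :=
  (Nat.finiteMultiplicity_iff.2 ⟨by omega, hi⟩).pow_dvd_iff_le_multiplicity

theorem mult_congr {m i j : ℕ} (hm : 1 ≤ m) (hi : 0 < i) (hj : 0 < j)
    (h : ∀ e, (m + 1) ^ e ∣ i ↔ (m + 1) ^ e ∣ j) :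
    multiplicity (m + 1) i = multiplicity (m + 1) j := by
  apply le_antisymm
  · rw [← pow_dvd_iff_le_mult hm hj, ← h, pow_dvd_iff_le_mult hm hi]
  · rw [← pow_dvd_iff_le_mult hm hi, h, pow_dvd_iff_le_mult hm hj]

theorem not_pow_dvd_of_mult_lt {m i e : ℕ} (hm : 1 ≤ m) (hi : 0 < i)
    (h : multiplicity (m + 1) i < e) : ¬ (m + 1) ^ e ∣ i := by
  rw [pow_dvd_iff_le_mult hm hi]; omega

section

variable {m : ℕ}

theorem cutPos_strictMono (hK : {k | curl (gPrefix (m + 1) k) ≤ m}.Infinite) :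
    StrictMono (cutPos m) := Nat.nth_strictMono hK

theorem cutPos_mem (hK : {k | curl (gPrefix (m + 1) k) ≤ m}.Infinite) (r : ℕ) :
    curl (gPrefix (m + 1) (cutPos m r)) ≤ m := Nat.nth_mem_of_infinite hK r

theorem exists_cutPos_eq {n : ℕ} (h : curl (gPrefix (m + 1) n) ≤ m) : ∃ r, cutPos m r = n :=
  ⟨_, Nat.nth_count (p := fun k => curl (gPrefix (m + 1) k) ≤ m) h⟩

theorem cutPos_zero (hm : 1 ≤ m) : cutPos m 0 = 0 := by
  apply Nat.nth_zero_of_zero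
  rw [curl_gPrefix_zero]; exact hm

theorem exists_mul_mem_Ico {d X : ℕ} (c : ℕ) (hd : 0 < d) (hX : ¬ d ∣ X)
    (hc0 : 1 ≤ c) : ∃ i, d ∣ i ∧ X < i + c * d ∧ i < X := by
  refine ⟨X / d * d, dvd_mul_left _ _, ?_, ?_⟩
  · have := Nat.lt_div_mul_add hd (a := X)
    nlinarith
  · exact lt_of_le_of_ne (Nat.div_mul_le_self _ _) fun h => hX (h ▸ dvd_mul_left _ _)

theorem curl_le_of_full_gap (hm : 1 ≤ m) (hK : {k | curl (gPrefix (m + 1) k) ≤ m}.Infinite)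
    {x g : ℕ} (hg : g = gapLen m (x + 1))
    (h : Gapped m (letter m) (letter (m + 1)) (gapLen m) (markerPos (gapLen m) x + 1 + g)) :
    curl (gPrefix m (markerPos (gapLen m) x + 1 + g)) ≤ m := by
  have hT := cutPos_strictMono hK
  by_contra! hc
  obtain ⟨p, hp⟩ := (le_curl_iff m _ (m + 1) (by omega)).1 hc
  rcases le_or_gt ((m + 1) * p) g with hpg | hpg
  · have := (le_curl_iff (m + 1) g (m + 1) (by omega)).2
      ⟨p, (h.endsPow_iff hg.le hpg).1 hp⟩
    have := cutPos_mem hK (multiplicity (m + 1) (x + 1))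
    rw [hg, gapLen] at *
    omega
  obtain ⟨y, hy⟩ := h.exists_shift hg.le (by omega) hp hpg
  have hy0 := hy.pos
  have hyx := hy.le
  have hmul := hy.mul_le
  have h2y : 2 * y ≤ (m + 1) * y := Nat.mul_le_mul_right y (by omega)
  have hX : multiplicity (m + 1) (x + 1) ≤ multiplicity (m + 1) (x - y + 1) := by
    have := hy.gap_le
    rw [hg, gapLen, gapLen, hT.le_iff_le] at this
    exact this
  have hey : (m + 1) ^ multiplicity (m + 1) (x + 1) ∣ y := by
    have h1 : (m + 1) ^ multiplicity (m + 1) (x + 1) ∣ x - y + 1 :=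
      (pow_dvd_iff_le_mult hm (by omega) _).2 hX
    have h2 : (m + 1) ^ multiplicity (m + 1) (x + 1) ∣ x + 1 :=
      (pow_dvd_iff_le_mult hm (by omega) _).2 le_rfl
    have := Nat.dvd_sub h2 h1
    rwa [show x + 1 - (x - y + 1) = y by omega] at this
  set f := multiplicity (m + 1) y with hf
  have hfy : (m + 1) ^ f ∣ y := (pow_dvd_iff_le_mult hm hy0 _).2 le_rfl
  have hfy' : ¬ (m + 1) ^ (f + 1) ∣ y := not_pow_dvd_of_mult_lt hm hy0 (by omega)
  have hef : multiplicity (m + 1) (x + 1) ≤ f := (pow_dvd_iff_le_mult hm hy0 _).1 hey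
  obtain ⟨i, hi1, hi2, hi3⟩ : ∃ i, (m + 1) ^ (f + 1) ∣ i ∧ x + 1 < i + (m + 1) * y ∧ i < x + 1 := by
    obtain ⟨u, hu⟩ := hfy
    have hu0 : 1 ≤ u := by
      rcases Nat.eq_zero_or_pos u with rfl | h
      · omega
      · exact h
    obtain ⟨i, h1, h2, h3⟩ := exists_mul_mem_Ico (X := x + 1) (d := (m + 1) ^ (f + 1)) u
      (by positivity) (not_pow_dvd_of_mult_lt hm (by omega) (by omega)) hu0
    refine ⟨i, h1, ?_, h3⟩
    have : (m + 1) * y = u * (m + 1) ^ (f + 1) := by rw [pow_succ]; nlinarith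
    omega
  have hi0 : 0 < i := by
    rcases Nat.eq_zero_or_pos i with rfl | h
    · omega
    · exact h
  have hmi : f + 1 ≤ multiplicity (m + 1) i := (pow_dvd_iff_le_mult hm hi0 _).1 hi1
  have hadd : multiplicity (m + 1) (i + y) = f := by
    apply le_antisymm
    · by_contra! hlt
      exact hfy' ((Nat.dvd_add_right hi1).1 ((pow_dvd_iff_le_mult hm (by omega) _).2 hlt))
    · rw [← pow_dvd_iff_le_mult hm (by omega)]
      exact dvd_add ((pow_dvd_pow _ (by omega)).trans hi1) hfy
  have hsub : y < i → multiplicity (m + 1) (i - y) = f := by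
    intro hlt
    apply le_antisymm
    · by_contra! hlt'
      apply hfy'
      have := Nat.dvd_sub hi1 ((pow_dvd_iff_le_mult hm (by omega) (f + 1)).2 hlt')
      rwa [show i - (i - y) = y by omega] at this
    · rw [← pow_dvd_iff_le_mult hm (by omega)]
      exact Nat.dvd_sub ((pow_dvd_pow _ (by omega)).trans hi1) hfy
  have below : ¬ (x + 1 < i - y + (m + 1) * y ∧ y < i) := by
    rintro ⟨h1, h2⟩
    have := hy.gap_eq h1 (by omega) (by omega)
    rw [show i - y + y = i by omega, gapLen, gapLen, hT.injective.eq_iff, hsub h2] at this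
    omega
  rcases lt_trichotomy (i + y) (x + 1) with hlt | heq | hgt
  · have := hy.gap_eq hi2 hlt hi0
    rw [gapLen, gapLen, hT.injective.eq_iff, hadd] at this
    omega
  · rw [heq] at hadd
    have hm1 : m = 1 := by
      by_contra hne
      have : 3 * y ≤ (m + 1) * y := Nat.mul_le_mul_right y (by omega)
      omega
    subst hm1
    have hyi : y < i := by
      rcases lt_trichotomy y i with h | h | h
      · exact h
      · rw [h] at hf; omega
      · omega
    have hi : x + 1 - y = i := by omega
    have hLi : g < gapLen 1 i := by
      rw [hg, gapLen, gapLen, hT.lt_iff_lt]; omega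
    have sq := h.square_gap hp hy (by omega)
      (by rw [show x + 1 - 2 * y = i - y by omega, hg, gapLen, gapLen, hsub hyi, hadd])
      (by rwa [hi])
    rw [hi] at sq
    have := (le_curl_iff (1 + 1) _ 2 le_rfl).2 ⟨_, sq.2⟩
    have := cutPos_mem hK (multiplicity (1 + 1) i)
    rw [gapLen] at *
    omega
  · exact below ⟨by omega, by omega⟩

end

section

variable {m : ℕ}

theorem pow_le_gap_of_partial_gap (hm : 1 ≤ m)
    (hK : {k | curl (gPrefix (m + 1) k) ≤ m}.Infinite) {x g k p : ℕ}
    (hg : g ≤ gapLen m (x + 1)) (hk : m + 2 ≤ k)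
    (h : Gapped m (letter m) (letter (m + 1)) (gapLen m) (markerPos (gapLen m) x + 1 + g))
    (hp : EndsPow (letter m) (markerPos (gapLen m) x + 1 + g) k p) : k * p ≤ g := by
  have hT := cutPos_strictMono hK
  by_contra! hpg
  obtain ⟨y, hy⟩ := h.exists_shift hg (by omega) hp hpg
  have hy0 := hy.pos
  have hyx := hy.le
  have hmul := hy.mul_le
  have h2y : (m + 1) * y + y ≤ k * y := by
    have := Nat.mul_le_mul_right y hk
    linarith
  have h2y' : 2 * y ≤ (m + 1) * y := Nat.mul_le_mul_right y (by omega)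
  set f := multiplicity (m + 1) y with hf
  have hfy : (m + 1) ^ f ∣ y := (pow_dvd_iff_le_mult hm hy0 _).2 le_rfl
  have hfy' : ¬ (m + 1) ^ (f + 1) ∣ y := not_pow_dvd_of_mult_lt hm hy0 (by omega)
  obtain ⟨i, hi1, hi2, hi3⟩ :
      ∃ i, (m + 1) ^ (f + 1) ∣ i ∧ x + 1 < i + y + (m + 1) * y ∧ i + y ≤ x + 1 := by
    by_cases hd : (m + 1) ^ (f + 1) ∣ x + 1 - y
    · exact ⟨x + 1 - y, hd, by omega, by omega⟩
    obtain ⟨u, hu⟩ := hfy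
    have hu0 : 1 ≤ u := by
      rcases Nat.eq_zero_or_pos u with rfl | h
      · omega
      · exact h
    obtain ⟨i, h1, h2, h3⟩ := exists_mul_mem_Ico u (by positivity) hd hu0
    refine ⟨i, h1, ?_, by omega⟩
    have : (m + 1) * y = u * (m + 1) ^ (f + 1) := by rw [pow_succ]; nlinarith
    omega
  have hi0 : 0 < i := by omega
  have hmi : f + 1 ≤ multiplicity (m + 1) i := (pow_dvd_iff_le_mult hm hi0 _).1 hi1
  rcases hi3.lt_or_eq with hlt | heq
  · have := hy.gap_eq (by omega) hlt hi0
    rw [gapLen, gapLen, hT.injective.eq_iff] at this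
    apply hfy'
    apply (Nat.dvd_add_right hi1).1
    rw [pow_dvd_iff_le_mult hm (by omega)]
    omega
  · have := hy.gap_eq (i := i - y) (by omega) (by omega) (by omega)
    rw [show i - y + y = i by omega, gapLen, gapLen, hT.injective.eq_iff] at this
    apply hfy'
    have := Nat.dvd_sub hi1 ((pow_dvd_iff_le_mult hm (by omega) (f + 1)).2 (this ▸ hmi))
    rwa [show i - (i - y) = y by omega] at this

/-- Equal gap lengths lead to equal shifts of marker positions. -/
theorem markerPos_add_of_gap_eq {L : ℕ → ℕ} {a b y p : ℕ}
    (hL : ∀ i, a < i → i ≤ b → L (i + y) = L i)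
    (ha : markerPos L (a + y) = markerPos L a + p) (i : ℕ) (h1 : a ≤ i) (h2 : i ≤ b) :
    markerPos L (i + y) = markerPos L i + p := by
  induction i, h1 using Nat.le_induction with
  | base => exact ha
  | succ i hi ih =>
    have := hL (i + 1) (by omega) h2
    rw [show i + 1 + y = i + y + 1 by omega] at this ⊢
    rw [markerPos_succ, markerPos_succ, ih (by omega), this]
    omega

/-- A shift of marker positions preserving gaps is a period of the word. -/
theorem Gapped.eq_add_of_shift {w v L : ℕ → ℕ} {n a b y p z : ℕ} (h : Gapped m w v L n)
    (hs : ∀ i, a ≤ i → i ≤ b → markerPos L (i + y) = markerPos L i + p)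
    (hL : L (b + 1) ≤ L (b + 1 + y))
    (h1 : markerPos L a ≤ z) (h2 : z < markerPos L (b + 1)) (h3 : z + p < n) :
    w z = w (z + p) := by
  have mono := markerPos_strictMono L
  obtain ⟨i, hi1, hi2⟩ := exists_markerPos_le L z
  have ai : a < i + 1 := mono.lt_iff_lt.1 (by omega)
  have ib : i < b + 1 := mono.lt_iff_lt.1 (by omega)
  have e := hs i (by omega) (by omega)
  rcases hi1.eq_or_lt with heq | hlt
  · rw [← heq, h.marker _ (by omega), ← e, h.marker _ (by omega)]
  · rw [markerPos_succ] at hi2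
    obtain ⟨g, rfl⟩ : ∃ g, z = markerPos L i + 1 + g := ⟨z - (markerPos L i + 1), by omega⟩
    have hle : L (i + 1) ≤ L (i + y + 1) := by
      rcases Nat.lt_or_ge i b with hib | hib
      · have e' := hs (i + 1) (by omega) (by omega)
        rw [show i + 1 + y = i + y + 1 by omega, markerPos_succ, markerPos_succ] at e'
        omega
      · rw [show i = b by omega, show b + y + 1 = b + 1 + y by omega]
        exact hL
    rw [h.gap i g (by omega) (by omega), show markerPos L i + 1 + g + p =
      markerPos L (i + y) + 1 + g by omega, h.gap _ _ (by omega) (by omega)]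

theorem mult_add_eq {i f : ℕ} (hm : 1 ≤ m) (hi : 0 < i) (h1 : ¬ (m + 1) ^ (f + 1) ∣ i)
    (h2 : ¬ (m + 1) ^ (f + 1) ∣ i + (m + 1) ^ f) :
    multiplicity (m + 1) (i + (m + 1) ^ f) = multiplicity (m + 1) i := by
  refine mult_congr hm (by omega) hi fun e => ?_
  rcases Nat.lt_or_ge f e with h | h
  · have : (m + 1) ^ (f + 1) ∣ (m + 1) ^ e := pow_dvd_pow _ h
    exact ⟨fun h' => absurd (this.trans h') h2, fun h' => absurd (this.trans h') h1⟩
  · exact Nat.dvd_add_left (pow_dvd_pow _ h)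

theorem endsPow_of_partial_gap (hm : 1 ≤ m)
    (hK : {k | curl (gPrefix (m + 1) k) ≤ m}.Infinite) {x g : ℕ}
    (hg : g < gapLen m (x + 1)) (hgK : curl (gPrefix (m + 1) g) ≤ m)
    (h : Gapped m (letter m) (letter (m + 1)) (gapLen m) (markerPos (gapLen m) x + 1 + g)) :
    ∃ p, EndsPow (letter m) (markerPos (gapLen m) x + 1 + g) (m + 1) p := by
  have hT := cutPos_strictMono hK
  obtain ⟨f, rfl⟩ := exists_cutPos_eq hgK
  rw [gapLen, hT.lt_iff_lt] at hg
  set y := (m + 1) ^ f with hy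
  have hy0 : 0 < y := by positivity
  have hdX : (m + 1) ^ (f + 1) ∣ x + 1 := (pow_dvd_iff_le_mult hm (by omega) _).2 hg
  have hyX : (m + 1) * y ≤ x + 1 := by
    have := Nat.le_of_dvd (by omega) hdX
    rwa [pow_succ, mul_comm] at this
  have h2y : 2 * y ≤ (m + 1) * y := Nat.mul_le_mul_right y (by omega)
  have nd : ∀ d, 0 < d → d < (m + 1) * y → d ≤ x + 1 → ¬ (m + 1) ^ (f + 1) ∣ x + 1 - d := by
    intro d hd hdy hdx hdvd
    have h1 := Nat.dvd_sub hdX hdvd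
    rw [show x + 1 - (x + 1 - d) = d by omega, pow_succ, mul_comm] at h1
    change (m + 1) * y ∣ d at h1
    exact absurd (Nat.le_of_dvd hd h1) (by omega)
  have hL : ∀ i, x + 1 < i + (m + 1) * y → i + y < x + 1 →
      gapLen m (i + y) = gapLen m i := by
    intro i h1 h2
    rw [gapLen, gapLen, mult_add_eq hm (by omega)]
    · have := nd (x + 1 - i) (by omega) (by omega) (by omega)
      rwa [show x + 1 - (x + 1 - i) = i by omega] at this
    · have := nd (x + 1 - i - y) (by omega) (by omega) (by omega)
      rwa [show x + 1 - (x + 1 - i - y) = i + y by omega] at this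
  have hLy : gapLen m (x + 1 - y) = cutPos m f := by
    rw [gapLen]
    congr 1
    apply le_antisymm
    · have := nd y hy0 (by omega) (by omega)
      rw [pow_dvd_iff_le_mult hm (by omega)] at this
      omega
    · rw [← pow_dvd_iff_le_mult hm (by omega)]
      exact Nat.dvd_sub ((pow_dvd_pow _ (by omega)).trans hdX) dvd_rfl
  have mono := markerPos_strictMono (gapLen m)
  set L := gapLen m with hLdef
  set a := x + 1 - (m + 1) * y with ha
  obtain ⟨p, hp⟩ : ∃ p, markerPos L (a + y) = markerPos L a + p :=
    ⟨_, (Nat.add_sub_cancel' (mono.monotone (by omega))).symm⟩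
  have shift := markerPos_add_of_gap_eq (b := x - y) (fun i h1 h2 => hL i (by omega) (by omega)) hp
  have hpx : markerPos L (x - y) + p = markerPos L x := by
    have := shift (x - y) (by omega) le_rfl
    rw [← this]; congr 1; omega
  have hend : markerPos L (x - y + 1) + p = markerPos L x + 1 + cutPos m f := by
    rw [markerPos_succ, show x - y + 1 = x + 1 - y by omega, hLy]
    omega
  have iter : ∀ r, r ≤ m → markerPos L (a + r * y) = markerPos L a + r * p := by
    intro r
    induction r with
    | zero => simp
    | succ r ih =>
      intro hr
      have : r * y + y + y ≤ (m + 1) * y := by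
        have := Nat.mul_le_mul_right y (show r + 2 ≤ m + 1 by omega)
        linarith
      rw [Nat.succ_mul, Nat.succ_mul, ← add_assoc, shift _ (by omega) (by omega), ih (by omega),
        add_assoc]
  have hlen : markerPos L a + (m + 1) * p = markerPos L x + 1 + cutPos m f := by
    have e := iter m le_rfl
    have hmul : (m + 1) * y = m * y + y := by ring
    rw [show a + m * y = x - y + 1 by omega] at e
    rw [← hend, e]; ring
  have hp0 : 0 < p := by
    have := mono (show a < a + y by omega)
    omega
  refine ⟨p, hp0, by omega, fun i hi hi' => ?_⟩
  refine h.eq_add_of_shift shift ?_ (by omega) (by omega) hi'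
  rw [show x - y + 1 = x + 1 - y by omega, hLy, show x + 1 - y + y = x + 1 by omega, hLdef, gapLen]
  exact hT.monotone (by omega)

theorem letter_of_partial_gap (hm : 1 ≤ m)
    (hK : {k | curl (gPrefix (m + 1) k) ≤ m}.Infinite) {x g : ℕ} (hg : g < gapLen m (x + 1))
    (h : Gapped m (letter m) (letter (m + 1)) (gapLen m) (markerPos (gapLen m) x + 1 + g)) :
    letter m (markerPos (gapLen m) x + 1 + g) = letter (m + 1) g := by
  set n := markerPos (gapLen m) x + 1 + g with hn
  have lift : ∀ k, 2 ≤ k → k ≤ curl (gPrefix (m + 1) g) → k ≤ curl (gPrefix m n) := by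
    intro k hk hkc
    obtain ⟨p, hp⟩ := (le_curl_iff _ _ _ hk).1 hkc
    exact (le_curl_iff _ _ _ hk).2 ⟨p, (h.endsPow_iff hg.le hp.2.1).2 hp⟩
  have low : m + 1 ≤ curl (gPrefix m n) := by
    by_cases hgK : curl (gPrefix (m + 1) g) ≤ m
    · exact (le_curl_iff _ _ _ (by omega)).2 (endsPow_of_partial_gap hm hK hg hgK h)
    · exact lift _ (by omega) (by omega)
  rw [letter, letter]
  apply le_antisymm
  · rcases low.eq_or_lt with heq | hlt
    · omega
    · obtain ⟨p, hp⟩ := (le_curl_iff m n _ (by omega)).1 le_rfl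
      have hle := pow_le_gap_of_partial_gap hm hK hg.le hlt h hp
      have := (le_curl_iff (m + 1) g (curl (gPrefix m n)) (by omega)).2
        ⟨p, (h.endsPow_iff hg.le hle).1 hp⟩
      omega
  · rcases Nat.lt_or_ge (curl (gPrefix (m + 1) g)) 2 with h2 | h2
    · omega
    · have := lift _ h2 le_rfl
      omega

/-- The structure theorem: `A^(m)` is a sequence of letters `m` separated by prefixes of
`A^(m+1)`. -/
theorem gapped_letter (hm : 1 ≤ m) (hK : {k | curl (gPrefix (m + 1) k) ≤ m}.Infinite) (n : ℕ) :
    Gapped m (letter m) (letter (m + 1)) (gapLen m) n := by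
  have hne : ∀ i, letter (m + 1) i ≠ m := fun i => by rw [letter]; omega
  induction n with
  | zero => exact ⟨hne, fun x hx => by omega, fun x g _ hx => by omega⟩
  | succ n ih =>
    refine ⟨hne, fun x hx => ?_, fun x g hg hx => ?_⟩
    · rcases Nat.lt_succ_iff_lt_or_eq.1 hx with hlt | heq
      · exact ih.marker x hlt
      rcases x with _ | x
      · exact letter_zero m hm
      · rw [markerPos_succ] at heq ⊢
        rw [letter, max_eq_left]
        exact curl_le_of_full_gap hm hK rfl (heq ▸ ih)
    · rcases Nat.lt_succ_iff_lt_or_eq.1 hx with hlt | heq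
      · exact ih.gap x g hg hlt
      · exact letter_of_partial_gap hm hK hg (heq ▸ ih)

end

section

variable {m : ℕ}

theorem letter_eq_iff (m n : ℕ) : letter m n = m ↔ curl (gPrefix m n) ≤ m := by
  rw [letter]; omega

theorem curl_le_iff_exists_markerPos (hm : 1 ≤ m)
    (hK : {k | curl (gPrefix (m + 1) k) ≤ m}.Infinite) (n : ℕ) :
    curl (gPrefix m n) ≤ m ↔ ∃ x, n = markerPos (gapLen m) x := by
  rw [← letter_eq_iff]
  have h := gapped_letter hm hK (n + 1)
  constructor
  · exact h.eq_markerPos (Nat.lt_succ_self n)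
  · rintro ⟨x, rfl⟩
    exact h.marker x (Nat.lt_succ_self _)

theorem piLen_eq_markerPos (hm : 1 ≤ m) (hK : {k | curl (gPrefix (m + 1) k) ≤ m}.Infinite)
    (hK' : {k | curl (gPrefix m k) ≤ m}.Infinite) (x : ℕ) :
    piLen m x = markerPos (gapLen m) x := by
  have : Nat.nth (fun k => curl (gPrefix m k) ≤ m) = markerPos (gapLen m) := by
    rw [← (Nat.nth_strictMono hK').range_inj (markerPos_strictMono _),
      Nat.range_nth_of_infinite hK']
    ext n
    simp only [Set.mem_ofPred_eq, Set.mem_range, curl_le_iff_exists_markerPos hm hK, eq_comm]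
  exact congrFun this x

theorem gapLen_pow_mul (hm : 1 ≤ m) {e j : ℕ} (hj : 0 < j) (hj' : j ≤ m) :
    gapLen m (j * (m + 1) ^ e) = cutPos m e := by
  have h0 : 0 < j * (m + 1) ^ e := by positivity
  rw [gapLen]
  congr 1
  apply le_antisymm
  · by_contra! h
    have := (pow_dvd_iff_le_mult hm h0 (e + 1)).2 h
    rw [pow_succ, mul_comm j] at this
    have := Nat.le_of_dvd hj (Nat.dvd_of_mul_dvd_mul_left (by positivity) this)
    omega
  · rw [← pow_dvd_iff_le_mult hm h0]
    exact dvd_mul_left _ _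

theorem gapLen_pow (hm : 1 ≤ m) (e : ℕ) : gapLen m ((m + 1) ^ e) = cutPos m e := by
  simpa using gapLen_pow_mul hm (e := e) one_pos hm

theorem gapLen_add_pow (hm : 1 ≤ m) {e i : ℕ} (hi : 0 < i)
    (h : i + (m + 1) ^ e < (m + 1) ^ (e + 1)) :
    gapLen m (i + (m + 1) ^ e) = gapLen m i := by
  have nd : ∀ d, 0 < d → d < (m + 1) ^ (e + 1) → ¬ (m + 1) ^ (e + 1) ∣ d :=
    fun d h1 h2 h3 => absurd (Nat.le_of_dvd h1 h3) (by omega)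
  rw [gapLen, mult_add_eq hm hi (nd _ hi (by omega)) (nd _ (by omega) h), gapLen]

theorem gapLen_add_mul_pow (hm : 1 ≤ m) {e i : ℕ} (j : ℕ) (hi : 0 < i)
    (h : i + j * (m + 1) ^ e < (m + 1) ^ (e + 1)) :
    gapLen m (i + j * (m + 1) ^ e) = gapLen m i := by
  induction j with
  | zero => simp
  | succ j ih =>
    rw [Nat.succ_mul] at h ⊢
    rw [← add_assoc, gapLen_add_pow hm (by omega) (by omega), ih (by omega)]

theorem markerPos_add_pow (hm : 1 ≤ m) {e i : ℕ} (h : i + (m + 1) ^ e < (m + 1) ^ (e + 1)) :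
    markerPos (gapLen m) (i + (m + 1) ^ e) =
      markerPos (gapLen m) i + markerPos (gapLen m) ((m + 1) ^ e) :=
  markerPos_add_of_gap_eq (a := 0) (b := i) (fun j h1 h2 => gapLen_add_pow hm h1 (by omega))
    (by simp) i (Nat.zero_le _) le_rfl

theorem markerPos_add_mul_pow (hm : 1 ≤ m) {e i : ℕ} (j : ℕ)
    (h : i + j * (m + 1) ^ e < (m + 1) ^ (e + 1)) :
    markerPos (gapLen m) (i + j * (m + 1) ^ e) =
      markerPos (gapLen m) i + j * markerPos (gapLen m) ((m + 1) ^ e) := by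
  induction j with
  | zero => simp
  | succ j ih =>
    rw [Nat.succ_mul] at h ⊢
    rw [Nat.succ_mul, ← add_assoc, markerPos_add_pow hm (by omega), ih (by omega), add_assoc]

theorem markerPos_mul_pow (hm : 1 ≤ m) {e j : ℕ} (hj : j ≤ m) :
    markerPos (gapLen m) (j * (m + 1) ^ e) = j * markerPos (gapLen m) ((m + 1) ^ e) := by
  have := markerPos_add_mul_pow hm (e := e) (i := 0) j (by
    rw [zero_add, pow_succ, mul_comm]
    exact Nat.mul_lt_mul_of_pos_left (by omega) (by positivity))
  simpa using this

theorem markerPos_pow_succ (hm : 1 ≤ m) (e : ℕ) :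
    markerPos (gapLen m) ((m + 1) ^ (e + 1)) + cutPos m e =
      (m + 1) * markerPos (gapLen m) ((m + 1) ^ e) + cutPos m (e + 1) := by
  have hq : 0 < (m + 1) ^ e := by positivity
  have hmq : 0 < m * (m + 1) ^ e := by positivity
  have e0 : (m + 1) ^ (e + 1) = m * (m + 1) ^ e + (m + 1) ^ e := by ring
  have e1 := markerPos_succ (gapLen m) (m * (m + 1) ^ e - 1)
  have e2 := markerPos_succ (gapLen m) (m * (m + 1) ^ e - 1 + (m + 1) ^ e)
  have e3 := markerPos_add_pow hm (e := e) (i := m * (m + 1) ^ e - 1) (by omega)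
  have e4 := markerPos_mul_pow hm (e := e) (j := m) le_rfl
  rw [show m * (m + 1) ^ e - 1 + 1 = m * (m + 1) ^ e by omega, gapLen_pow_mul hm hm le_rfl] at e1
  rw [show m * (m + 1) ^ e - 1 + (m + 1) ^ e + 1 = (m + 1) ^ (e + 1) by omega,
    gapLen_pow hm] at e2
  rw [add_mul, one_mul]
  omega

theorem letter_add_markerPos_pow (hm : 1 ≤ m)
    (hK : {k | curl (gPrefix (m + 1) k) ≤ m}.Infinite) {e z : ℕ}
    (hz : z < m * markerPos (gapLen m) ((m + 1) ^ e)) :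
    letter m z = letter m (z + markerPos (gapLen m) ((m + 1) ^ e)) := by
  have hmq : 0 < m * (m + 1) ^ e := by positivity
  have e0 : (m + 1) ^ (e + 1) = m * (m + 1) ^ e + (m + 1) ^ e := by ring
  refine (gapped_letter hm hK (z + markerPos (gapLen m) ((m + 1) ^ e) + 1)).eq_add_of_shift
    (a := 0) (b := m * (m + 1) ^ e - 1) (y := (m + 1) ^ e)
    (fun i _ hi => markerPos_add_pow hm (by omega)) ?_ (by simp) ?_ (by omega)
  · rw [show m * (m + 1) ^ e - 1 + 1 = m * (m + 1) ^ e by omega, gapLen_pow_mul hm hm le_rfl,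
      ← e0, gapLen_pow hm]
    exact (cutPos_strictMono hK).monotone (by omega)
  · rw [show m * (m + 1) ^ e - 1 + 1 = m * (m + 1) ^ e by omega, markerPos_mul_pow hm le_rfl]
    exact hz

theorem letter_add_mul_markerPos_pow (hm : 1 ≤ m)
    (hK : {k | curl (gPrefix (m + 1) k) ≤ m}.Infinite) {e z : ℕ} (j : ℕ)
    (hz : z + j * markerPos (gapLen m) ((m + 1) ^ e) <
      (m + 1) * markerPos (gapLen m) ((m + 1) ^ e)) :
    letter m z = letter m (z + j * markerPos (gapLen m) ((m + 1) ^ e)) := by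
  induction j with
  | zero => simp
  | succ j ih =>
    rw [Nat.succ_mul, add_mul m, one_mul] at *
    rw [ih (by omega), letter_add_markerPos_pow hm hK (e := e) (by omega), add_assoc]

/-- A power ending a prefix persists under a shift preserving the letters it covers. -/
theorem EndsPow.of_shift {w : ℕ → ℕ} {n k p s : ℕ} (h : EndsPow w (n + s) k p) (hk : k * p ≤ n)
    (hw : ∀ z, z < n → w z = w (z + s)) : EndsPow w n k p := by
  refine ⟨h.1, hk, fun i hi hi' => ?_⟩
  rw [hw i (by omega), hw _ hi', h.2.2 _ (by omega) (by omega)]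
  congr 1; omega

theorem EndsPow.shift {w : ℕ → ℕ} {n k p s : ℕ} (h : EndsPow w n k p)
    (hw : ∀ z, z < n → w z = w (z + s)) : EndsPow w (n + s) k p := by
  have hk := h.2.1
  refine ⟨h.1, by omega, fun i hi hi' => ?_⟩
  obtain ⟨i, rfl⟩ : ∃ j, i = j + s := ⟨i - s, by omega⟩
  rw [← hw i (by omega), h.2.2 _ (by omega) (by omega), hw _ (by omega)]
  congr 1; omega

/-- Prefixes ending in the same letters at a distance of a multiple of `B_{e+1}`. -/
theorem curl_le_curl_add_markerPos (hm : 1 ≤ m)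
    (hK : {k | curl (gPrefix (m + 1) k) ≤ m}.Infinite) {e n : ℕ} (j : ℕ)
    (hn : n + j * markerPos (gapLen m) ((m + 1) ^ e) ≤
      (m + 1) * markerPos (gapLen m) ((m + 1) ^ e)) :
    curl (gPrefix m n) ≤ curl (gPrefix m (n + j * markerPos (gapLen m) ((m + 1) ^ e))) := by
  rcases Nat.lt_or_ge (curl (gPrefix m n)) 2 with h2 | h2
  · have := one_le_curl (gPrefix m (n + j * markerPos (gapLen m) ((m + 1) ^ e)))
    omega
  · obtain ⟨p, hp⟩ := (le_curl_iff m n _ h2).1 le_rfl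
    exact (le_curl_iff m _ _ h2).2 ⟨p, hp.shift fun z hz =>
      letter_add_mul_markerPos_pow hm hK j (by omega)⟩

end

section

variable {m : ℕ}

theorem gapLen_lt_of_lt_pow (hm : 1 ≤ m) (hK : {k | curl (gPrefix (m + 1) k) ≤ m}.Infinite)
    {e y : ℕ} (h : ¬ (m + 1) ^ e ∣ y) (hy : 0 < y) : gapLen m y < cutPos m e := by
  rw [pow_dvd_iff_le_mult hm hy] at h
  exact cutPos_strictMono hK (by omega)

theorem gapLen_pow_sub (hm : 1 ≤ m) {e y : ℕ} (hy : 0 < y) (h : y < (m + 1) ^ e) :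
    gapLen m ((m + 1) ^ e - y) = gapLen m y := by
  rw [gapLen, gapLen]
  congr 1
  refine mult_congr hm (by omega) hy fun f => ?_
  rcases le_or_gt f e with hf | hf
  · have hd : (m + 1) ^ f ∣ (m + 1) ^ e := pow_dvd_pow _ hf
    constructor
    · intro h'
      have := Nat.dvd_sub hd h'
      rwa [show (m + 1) ^ e - ((m + 1) ^ e - y) = y by omega] at this
    · exact Nat.dvd_sub hd
  · have : (m + 1) ^ e ≤ (m + 1) ^ f := Nat.pow_le_pow_right (by omega) hf.le
    exact ⟨fun h' => absurd (Nat.le_of_dvd (by omega) h') (by omega),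
      fun h' => absurd (Nat.le_of_dvd (by omega) h') (by omega)⟩

theorem gapLen_le_gapLen_mul (hm : 1 ≤ m) (hK : {k | curl (gPrefix (m + 1) k) ≤ m}.Infinite)
    {y k : ℕ} (hy : 0 < y) (hk : 0 < k) : gapLen m y ≤ gapLen m (k * y) := by
  refine (cutPos_strictMono hK).monotone ?_
  rw [← pow_dvd_iff_le_mult hm (by positivity)]
  exact Dvd.dvd.mul_left ((pow_dvd_iff_le_mult hm hy _).2 le_rfl) _

/-- Repeating `B_{e+1}` does not create `m`-th powers at the end of prefixes, except possibly for
squares when `m = 2`. -/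
theorem curl_lt_markerPos_add_mul_pow (hm : 2 ≤ m)
    (hK : {k | curl (gPrefix (m + 1) k) ≤ m}.Infinite) {e X j : ℕ} (hX : 0 < X)
    (hXq : X ≤ (m + 1) ^ e) (hj : 0 < j) (hjX : X + j * (m + 1) ^ e < m * (m + 1) ^ e)
    (hcut : curl (gPrefix m (markerPos (gapLen m) X)) < m)
    (hgood : m = 2 → gapLen m X < cutPos m e → cutPos m e ≤ 2 * gapLen m X →
      curl (gPrefix (m + 1) (cutPos m e)) ≤ 1) :
    curl (gPrefix m (markerPos (gapLen m) (X + j * (m + 1) ^ e))) < m := by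
  have hm1 : 1 ≤ m := by omega
  by_contra! hc
  obtain ⟨p, hp⟩ := (le_curl_iff m _ m hm).1 hc
  have epow : (m + 1) ^ (e + 1) = m * (m + 1) ^ e + (m + 1) ^ e := by ring
  have hjm : j < m := by
    by_contra! h
    have := Nat.mul_le_mul_right ((m + 1) ^ e) h
    omega
  have hpos := markerPos_add_mul_pow hm1 (e := e) (i := X) j (by omega)
  have hposj := markerPos_mul_pow hm1 (e := e) (j := j) (by omega)
  have hgapX := gapLen_add_mul_pow hm1 (e := e) j hX (by omega)
  have hmono := markerPos_strictMono (gapLen m)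
  have hTm := cutPos_strictMono hK
  rcases le_or_gt (m * p) (markerPos (gapLen m) X) with hle | hgt
  · rw [hpos] at hp
    refine absurd ((le_curl_iff m _ m hm).2 ⟨p, hp.of_shift hle fun z hz => ?_⟩) (by omega)
    refine letter_add_mul_markerPos_pow hm1 hK j ?_
    have h1 : markerPos (gapLen m) X ≤ markerPos (gapLen m) ((m + 1) ^ e) := hmono.monotone hXq
    have h2 := Nat.mul_le_mul_right (markerPos (gapLen m) ((m + 1) ^ e)) (show j + 1 ≤ m by omega)
    rw [add_mul] at h2 ⊢
    omega
  set q := (m + 1) ^ e with hq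
  have hq0 : 0 < q := by positivity
  obtain ⟨x, hx⟩ : ∃ x, X + j * q = x + 1 := ⟨X + j * q - 1, by omega⟩
  have e1 := markerPos_succ (gapLen m) x
  have e2 := markerPos_succ (gapLen m) (X - 1)
  rw [show X - 1 + 1 = X by omega] at e2
  rw [hx] at hp hpos hgapX
  rw [e1] at hp
  have G := gapped_letter hm1 hK (markerPos (gapLen m) x + 1 + gapLen m (x + 1))
  obtain ⟨y, hy⟩ := G.exists_shift le_rfl hm hp (by omega)
  have hy0 := hy.pos
  have hyx := hy.le
  have hmul := hy.mul_le
  have win := (hy.window (j * q)).1 (by omega)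
  have hyq : y < q := by
    by_contra! h
    have := Nat.mul_le_mul_left m h
    omega
  have hjq : q ≤ j * q := Nat.le_mul_of_pos_left q hj
  have ndvd : ¬ q ∣ y := fun h => absurd (Nat.le_of_dvd hy0 h) (by omega)
  have hgapy : y < X → gapLen m (j * q + y) = gapLen m y := fun h => by
    rw [add_comm]; exact gapLen_add_mul_pow hm1 (e := e) j hy0 (by rw [← hq]; omega)
  have hgapj : gapLen m (j * q) = cutPos m e := gapLen_pow_mul hm1 hj hjm.le
  have h2y : 2 * y ≤ m * y := Nat.mul_le_mul_right y hm
  rcases eq_or_ne X (m * y) with hXy | hXy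
  · have f1 := hy.shift (j * q) (by omega) (by omega)
    have hmy : (m - 1) * y + y = m * y := by
      obtain ⟨c, rfl⟩ : ∃ c, m = c + 1 := ⟨m - 1, by omega⟩
      simp; ring
    have hmp : (m - 1) * p + p = m * p := by
      obtain ⟨c, rfl⟩ : ∃ c, m = c + 1 := ⟨m - 1, by omega⟩
      simp; ring
    have f2 := hy.iterate (i := j * q + y - 1) (m - 1) (by omega) (by omega)
    rw [show j * q + y - 1 + (m - 1) * y = x by omega] at f2
    have f3 := markerPos_succ (gapLen m) (j * q + y - 1)
    rw [show j * q + y - 1 + 1 = j * q + y by omega, hgapy (by omega)] at f3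
    have := gapLen_le_gapLen_mul hm1 hK hy0 (show 0 < m by omega)
    rw [← hXy] at this
    omega
  rcases Nat.lt_or_ge y X with ha | ha
  · have f := hy.gap_eq (i := j * q) (by omega) (by omega) (by omega)
    rw [hgapy ha, hgapj] at f
    have := gapLen_lt_of_lt_pow hm1 hK ndvd hy0
    omega
  rcases Nat.lt_or_ge (X + y) (m * y) with hb | hb
  · have f := hy.gap_eq (i := j * q - y) (by omega) (by omega) (by omega)
    rw [show j * q - y + y = j * q by omega, hgapj] at f
    have := gapLen_lt_of_lt_pow hm1 hK (e := e) (y := j * q - y) (fun h => ndvd (by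
      have := Nat.dvd_sub (dvd_mul_left q j) h
      rwa [show j * q - (j * q - y) = y by omega] at this)) (by omega)
    omega
  have hm2 : m = 2 := by
    by_contra hne
    have : 3 * y ≤ m * y := Nat.mul_le_mul_right y (by omega)
    omega
  obtain rfl : j = 1 := by omega
  obtain rfl : X = y := by rw [hm2] at hb; omega
  have hy2 : GapShift (gapLen m) x (gapLen m (x + 1)) 2 p X := by
    convert hy using 1
    exact hm2.symm
  rw [one_mul] at *
  have hXT := gapLen_lt_of_lt_pow hm1 hK ndvd hy0
  have sq := G.square_gap (hp.anti hm) hy2 (by omega)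
    (by rw [show x + 1 - 2 * X = q - X by omega, hgapX]; exact gapLen_pow_sub hm1 hX hyq)
    (by rw [show x + 1 - X = q by omega, hgapj, hgapX]; exact hXT)
  rw [show x + 1 - X = q by omega, hgapj, hgapX] at sq
  have := (le_curl_iff (m + 1) _ 2 le_rfl).2 ⟨_, sq.2⟩
  have := hgood hm2 hXT sq.1
  omega

end

/-- The repetitions of `B_{e+1}` at the start of `A^(m)` create no new squares when `m = 2`. -/
def Liftable (m e : ℕ) : Prop :=
  m = 2 → ∀ i < e, cutPos m e ≤ 2 * cutPos m i → curl (gPrefix (m + 1) (cutPos m i)) ≤ 1 →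
    curl (gPrefix (m + 1) (cutPos m e)) ≤ 1

theorem cutPos_eq_nth (m : ℕ) :
    cutPos m = Nat.nth (fun k => curl (gPrefix (m + 1) k) < m + 1) := by
  funext r
  simp only [cutPos, Nat.lt_succ_iff]

section

variable {m : ℕ}

theorem curl_gapLen_le (hm : 1 ≤ m) (hK : {k | curl (gPrefix (m + 1) k) ≤ m}.Infinite)
    {X : ℕ} (hX : 0 < X) :
    curl (gPrefix (m + 1) (gapLen m X)) ≤ curl (gPrefix m (markerPos (gapLen m) X)) := by
  rcases Nat.lt_or_ge (curl (gPrefix (m + 1) (gapLen m X))) 2 with h2 | h2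
  · have := one_le_curl (gPrefix m (markerPos (gapLen m) X))
    omega
  obtain ⟨X, rfl⟩ : ∃ x, X = x + 1 := ⟨X - 1, by omega⟩
  obtain ⟨p, hp⟩ := (le_curl_iff _ _ _ h2).1 le_rfl
  rw [markerPos_succ]
  exact (le_curl_iff _ _ _ h2).2
    ⟨p, ((gapped_letter hm hK _).endsPow_iff le_rfl hp.2.1).2 hp⟩

theorem exists_liftable (hK : {k | curl (gPrefix (m + 1) k) ≤ m}.Infinite)
    (e₀ : ℕ) : ∃ e, e₀ ≤ e ∧ Liftable m e := by
  have hT := cutPos_strictMono hK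
  by_contra! h
  obtain ⟨j, hj⟩ : ∃ j, 2 * cutPos m e₀ < cutPos m j := ⟨_, hT.le_apply (x := 2 * cutPos m e₀ + 1)⟩
  have key : ∀ e, e₀ ≤ e → ∃ i < e, cutPos m e ≤ 2 * cutPos m i ∧
      curl (gPrefix (m + 1) (cutPos m i)) ≤ 1 ∧ 1 < curl (gPrefix (m + 1) (cutPos m e)) := by
    intro e he
    have := h e he
    rw [Liftable] at this
    push Not at this
    exact this.2
  obtain ⟨i, hi, h1, h2, -⟩ := key (max e₀ j) (le_max_left _ _)
  have hie : i < e₀ := by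
    by_contra! hc
    obtain ⟨-, -, -, -, h3⟩ := key i hc
    omega
  have := hT hie
  have := hT.monotone (le_max_right e₀ j)
  omega

theorem curl_lt_add_markerPos_iff (hm : 2 ≤ m)
    (hK : {k | curl (gPrefix (m + 1) k) ≤ m}.Infinite) {e x : ℕ} (he : Liftable m e) (hx : 0 < x)
    (hxB : x + markerPos (gapLen m) ((m + 1) ^ e) < m * markerPos (gapLen m) ((m + 1) ^ e)) :
    curl (gPrefix m (x + markerPos (gapLen m) ((m + 1) ^ e))) < m ↔ curl (gPrefix m x) < m := by
  have hm1 : 1 ≤ m := by omega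
  have hmono := markerPos_strictMono (gapLen m)
  constructor
  · refine lt_of_le_of_lt ?_
    have := curl_le_curl_add_markerPos hm1 hK (e := e) (n := x) 1 (by rw [add_mul]; omega)
    rwa [one_mul] at this
  intro h
  obtain ⟨M, rfl⟩ := (curl_le_iff_exists_markerPos hm1 hK x).1 h.le
  have hM : 0 < M := hmono.lt_iff_lt.1 (by rwa [markerPos_zero])
  have epow : (m + 1) ^ (e + 1) = m * (m + 1) ^ e + (m + 1) ^ e := by ring
  have hq : 0 < (m + 1) ^ e := by positivity
  have hMq : M < m * (m + 1) ^ e := by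
    apply hmono.lt_iff_lt.1
    rw [markerPos_mul_pow hm1 le_rfl]
    omega
  have hMq' : M + (m + 1) ^ e < m * (m + 1) ^ e := by
    apply hmono.lt_iff_lt.1
    rw [markerPos_mul_pow hm1 le_rfl, markerPos_add_pow hm1 (by omega)]
    omega
  rw [← markerPos_add_pow hm1 (by omega)]
  obtain ⟨j, X, hX, hXq, rfl⟩ : ∃ j X, 0 < X ∧ X ≤ (m + 1) ^ e ∧ M = X + j * (m + 1) ^ e := by
    refine ⟨(M - 1) / (m + 1) ^ e, (M - 1) % (m + 1) ^ e + 1, Nat.succ_pos _, Nat.mod_lt _ hq, ?_⟩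
    have := Nat.mod_add_div (M - 1) ((m + 1) ^ e)
    rw [mul_comm] at this
    omega
  have hX' : curl (gPrefix m (markerPos (gapLen m) X)) < m := by
    refine lt_of_le_of_lt ?_ h
    rw [markerPos_add_mul_pow hm1 j (by omega)]
    refine curl_le_curl_add_markerPos hm1 hK j ?_
    rw [← markerPos_add_mul_pow hm1 j (by omega), add_mul]
    omega
  rw [add_assoc, ← Nat.succ_mul] at hMq' ⊢
  refine curl_lt_markerPos_add_mul_pow hm hK hX hXq (Nat.succ_pos j) hMq' hX' ?_
  intro hm2 h1 h2
  refine he hm2 (multiplicity (m + 1) X) ((cutPos_strictMono hK).lt_iff_lt.1 h1) h2 ?_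
  have := curl_gapLen_le hm1 hK hX
  rw [gapLen] at this
  omega

theorem le_curl_of_mem_Ico (hm : 2 ≤ m)
    (hK : {k | curl (gPrefix (m + 1) k) ≤ m}.Infinite) {e n : ℕ}
    (h1 : m * markerPos (gapLen m) ((m + 1) ^ e) ≤ n)
    (h2 : n < (m + 1) * markerPos (gapLen m) ((m + 1) ^ e)) : m ≤ curl (gPrefix m n) := by
  have h0 : 0 < markerPos (gapLen m) ((m + 1) ^ e) := by
    rcases Nat.eq_zero_or_pos (markerPos (gapLen m) ((m + 1) ^ e)) with h | h
    · rw [h] at h2; omega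
    · exact h
  rw [add_mul] at h2
  exact (le_curl_iff _ _ _ hm).2 ⟨_, h0, h1, fun i hi hi' =>
    letter_add_markerPos_pow (by omega) hK (by omega)⟩

/-- The number of short prefixes of `A^(m)` with curling number below `m`. -/
noncomputable def cutCount (m e : ℕ) : ℕ :=
  ((Finset.range ((m + 1) ^ e)).filter fun X =>
    ¬ (m + 1) ∣ X ∧ curl (gPrefix m (markerPos (gapLen m) X)) < m).card

theorem gapLen_of_not_dvd (hm : 1 ≤ m) {X : ℕ} (h : ¬ (m + 1) ∣ X) : gapLen m X = 0 := by
  rw [gapLen, multiplicity_eq_zero.2 h, cutPos_zero hm]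

theorem two_mul_cutCount_le (hm : 2 ≤ m) (hK : {k | curl (gPrefix (m + 1) k) ≤ m}.Infinite)
    {e : ℕ} (he : 1 ≤ e) : 2 * cutCount m e ≤ cutCount m (e + 1) := by
  rw [cutCount, cutCount, two_mul]
  set q := (m + 1) ^ e with hq
  set s := (Finset.range q).filter fun X =>
    ¬ (m + 1) ∣ X ∧ curl (gPrefix m (markerPos (gapLen m) X)) < m with hs
  have hqd : (m + 1) ∣ q := dvd_pow_self _ (by omega)
  have epow : (m + 1) ^ (e + 1) = m * q + q := by rw [hq]; ring
  have hmq : 2 * q ≤ m * q := Nat.mul_le_mul_right q hm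
  have hdisj : Disjoint s (s.map (addRightEmbedding q)) := by
    rw [Finset.disjoint_left]
    intro X h1 h2
    simp [hs] at h1 h2
    obtain ⟨a, -, rfl⟩ := h2
    omega
  nth_rw 2 [← Finset.card_map (addRightEmbedding q)]
  rw [← Finset.card_union_of_disjoint hdisj]
  apply Finset.card_le_card
  intro X hX
  rcases Finset.mem_union.1 hX with h | h
  · simp only [hs, Finset.mem_filter, Finset.mem_range] at h ⊢
    exact ⟨by omega, h.2⟩
  · obtain ⟨X, h', rfl⟩ := Finset.mem_map.1 h
    clear h hX
    obtain ⟨h1, h2, h3⟩ : X < q ∧ ¬ (m + 1) ∣ X ∧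
        curl (gPrefix m (markerPos (gapLen m) X)) < m := by simpa [hs] using h'
    simp only [Finset.mem_filter, Finset.mem_range, addRightEmbedding_apply]
    refine ⟨by omega, fun h' => h2 ((Nat.dvd_add_left hqd).1 h'), ?_⟩
    have hX0 : 0 < X := Nat.pos_of_ne_zero fun h0 => h2 (h0 ▸ dvd_zero _)
    have hg := gapLen_of_not_dvd (by omega) h2
    have := curl_lt_markerPos_add_mul_pow hm hK (e := e) (j := 1) hX0 h1.le one_pos
      (by rw [← hq]; omega) h3 (by rw [hg]; intros; omega)
    rwa [one_mul] at this

theorem markerPos_of_le (hm : 1 ≤ m) {j : ℕ} (hj : j ≤ m) : markerPos (gapLen m) j = j := by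
  have := markerPos_mul_pow hm (e := 0) hj
  have h1 : markerPos (gapLen m) 1 = 1 := by
    rw [show 1 = 0 + 1 from rfl, markerPos_succ, gapLen_of_not_dvd hm (by simp; omega)]
    simp
  simpa [h1] using this

theorem le_cutCount_one (hm : 2 ≤ m) : m - 1 ≤ cutCount m 1 := by
  have : (Finset.Icc 1 (m - 1)).card = m - 1 := by simp
  rw [← this, cutCount]
  apply Finset.card_le_card
  intro X hX
  rw [Finset.mem_Icc] at hX
  simp only [Finset.mem_filter, Finset.mem_range, pow_one]
  refine ⟨by omega, fun h => absurd (Nat.le_of_dvd (by omega) h) (by omega), ?_⟩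
  rw [markerPos_of_le (by omega) (by omega)]
  have := curl_gPrefix_le m X hX.1
  omega

theorem le_cutCount (hm : 2 ≤ m) (hK : {k | curl (gPrefix (m + 1) k) ≤ m}.Infinite) (e : ℕ) :
    2 ^ e * (m - 1) ≤ cutCount m (e + 1) := by
  induction e with
  | zero => simpa using le_cutCount_one hm
  | succ e ih =>
    have := two_mul_cutCount_le hm hK (e := e + 1) (by omega)
    rw [pow_succ]
    linarith

theorem nth_lt_markerPos_pow (hm : 2 ≤ m) {e r : ℕ} (hr : r ≤ cutCount m e) :
    Nat.nth (fun k => curl (gPrefix m k) < m) r < markerPos (gapLen m) ((m + 1) ^ e) := by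
  apply Nat.nth_lt_of_lt_count
  rw [Nat.count_eq_card_filter_range]
  refine lt_of_le_of_lt hr ?_
  have hmono := markerPos_strictMono (gapLen m)
  rw [cutCount, ← Finset.card_map ⟨markerPos (gapLen m), hmono.injective⟩]
  apply Finset.card_lt_card
  rw [Finset.ssubset_iff_of_subset]
  · refine ⟨0, ?_, ?_⟩
    · simp only [Finset.mem_filter, Finset.mem_range, curl_gPrefix_zero]
      exact ⟨lt_of_le_of_lt (Nat.zero_le _) (hmono (show 0 < (m + 1) ^ e by positivity)), by omega⟩
    · intro h
      obtain ⟨X, hX, hX'⟩ := Finset.mem_map.1 h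
      have : X = 0 := hmono.injective (by simpa using hX')
      simp [this] at hX
  · intro n hn
    obtain ⟨X, hX, rfl⟩ := Finset.mem_map.1 hn
    simp only [Finset.mem_filter, Finset.mem_range, Function.Embedding.coeFn_mk] at hX ⊢
    exact ⟨hmono hX.1, hX.2.2⟩

end

section

variable {κ : ℕ → Prop} {B c : ℕ}

theorem count_add_period (hs : ∀ x, 0 < x → x + B < c * B → (κ (x + B) ↔ κ x)) (h0 : κ 0) {x : ℕ}
    (hx : x + B < c * B) :
    Nat.count κ (x + B + 1) + 1 = Nat.count κ (B + 1) + Nat.count κ (x + 1) := by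
  have e : Nat.count (fun k => κ (B + 1 + k)) x = Nat.count (fun k => κ (1 + k)) x := by
    rw [Nat.count_eq_card_filter_range, Nat.count_eq_card_filter_range]
    congr 1
    refine Finset.filter_congr fun k hk => ?_
    rw [Finset.mem_range] at hk
    rw [← hs (1 + k) (by omega) (by omega), add_comm B 1, add_right_comm]
  rw [show x + B + 1 = B + 1 + x by omega, Nat.count_add κ (B + 1), add_comm x 1,
    Nat.count_add κ 1, e, show Nat.count κ 1 = 1 by simp [Nat.count_succ, h0]]
  omega

/-- The enumeration of a set that starts with a periodic block of length `c * B` followed by a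
hole of length `B`. -/
theorem exists_nth_block (hκ : {k | κ k}.Infinite) (h0 : κ 0) (hB : 0 < B) (hc : 2 ≤ c)
    (hs : ∀ x, 0 < x → x + B < c * B → (κ (x + B) ↔ κ x))
    (hg : ∀ n, c * B ≤ n → n < (c + 1) * B → ¬ κ n) :
    ∃ n N, c * n ≤ N ∧ (∀ r, r ≤ n ↔ Nat.nth κ r ≤ B) ∧
      (∀ r, 1 ≤ r → r + n < N → Nat.nth κ (r + n) = Nat.nth κ r + B) ∧
      (∀ r, r < N → Nat.nth κ r < c * B) ∧ (∀ r, N ≤ r → (c + 1) * B ≤ Nat.nth κ r) := by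
  have hlt : ∀ a b, a < Nat.count κ b ↔ Nat.nth κ a < b := fun a b => Nat.lt_nth_iff_count_lt hκ
  have hcount : ∀ r, Nat.count κ (Nat.nth κ r) = r := Nat.count_nth_of_infinite hκ
  have hpos : 0 < Nat.count κ (B + 1) := (hlt _ _).2 (by rw [Nat.nth_zero_of_zero h0]; omega)
  refine ⟨Nat.count κ (B + 1) - 1, Nat.count κ (c * B), ?_, fun r => ?_, fun r hr hrN => ?_,
    fun r hr => (hlt _ _).1 hr, fun r hr => ?_⟩
  · have key : ∀ j, 1 ≤ j → j < c →
        Nat.count κ (j * B + 1) = j * (Nat.count κ (B + 1) - 1) + 1 := by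
      intro j hj
      induction j, hj using Nat.le_induction with
      | base => intro _; rw [one_mul, one_mul]; omega
      | succ j hj ih =>
        intro hjc
        have h1 := Nat.mul_lt_mul_of_pos_right hjc hB
        have h2 := count_add_period hs h0 (x := j * B) (by rw [add_mul, one_mul] at h1; exact h1)
        have h3 := ih (by omega)
        rw [add_mul, one_mul, add_mul, one_mul]
        omega
    obtain ⟨c, rfl⟩ : ∃ d, c = d + 2 := ⟨c - 2, by omega⟩
    have h1 := key (c + 1) (by omega) (by omega)
    have hcB : 0 < (c + 1) * B := by positivity
    have e : (c + 2) * B = (c + 1) * B + B := by ring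
    have h2 := count_add_period hs h0 (x := (c + 1) * B - 1) (by omega)
    rw [show (c + 1) * B - 1 + B + 1 = (c + 2) * B by omega,
      show (c + 1) * B - 1 + 1 = (c + 1) * B by omega] at h2
    have h3 : Nat.count κ ((c + 1) * B + 1) ≤ Nat.count κ ((c + 1) * B) + 1 := by
      rw [Nat.count_succ]; split_ifs <;> omega
    have e' : (c + 2) * (Nat.count κ (B + 1) - 1) =
      (c + 1) * (Nat.count κ (B + 1) - 1) + (Nat.count κ (B + 1) - 1) := by ring
    omega
  · have := hlt r (B + 1)
    omega
  · have h1 := (hlt _ _).1 hrN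
    have h2 : ¬ Nat.nth κ (r + (Nat.count κ (B + 1) - 1)) < B + 1 := by
      rw [← hlt]; omega
    obtain ⟨x, hx⟩ : ∃ x, Nat.nth κ (r + (Nat.count κ (B + 1) - 1)) = x + 1 + B :=
      ⟨Nat.nth κ (r + (Nat.count κ (B + 1) - 1)) - 1 - B, by omega⟩
    have h3 := Nat.nth_mem_of_infinite hκ (r + (Nat.count κ (B + 1) - 1))
    have h4 := hcount (r + (Nat.count κ (B + 1) - 1))
    rw [hx] at h1 h3 h4 ⊢
    rw [hs _ (by omega) h1] at h3
    have h5 := count_add_period hs h0 (x := x) (by omega)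
    rw [show x + 1 + B = x + B + 1 by omega] at h4
    rw [← Nat.nth_count h3, show Nat.count κ (x + 1) = r by omega]
  · have h1 : ¬ Nat.nth κ r < c * B := by rw [← hlt]; omega
    by_contra! h2
    exact hg _ (by omega) h2 (Nat.nth_mem_of_infinite hκ r)

end

section

variable {m : ℕ}

theorem cutPos_one_le (hm : 1 ≤ m) : cutPos m 1 ≤ 1 := by
  refine Nat.lt_succ_iff.1 (Nat.nth_lt_of_lt_count ?_)
  have := curl_gPrefix_le (m + 1) 1 le_rfl
  simp [Nat.count_succ, curl_gPrefix_zero, hm, this.trans hm]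

theorem two_pow_le_cutCount (hm : 2 ≤ m) (hK : {k | curl (gPrefix (m + 1) k) ≤ m}.Infinite)
    (e : ℕ) : 2 ^ e ≤ cutCount m (e + 1) :=
  (Nat.le_mul_of_pos_right _ (by omega)).trans (le_cutCount hm hK e)

theorem cutPos_lt_markerPos_pow (hm : 1 ≤ m) {e r : ℕ} (hr : r ≤ cutCount (m + 1) e) :
    cutPos m r < markerPos (gapLen (m + 1)) ((m + 2) ^ e) := by
  rw [cutPos_eq_nth]
  exact nth_lt_markerPos_pow (by omega) hr

theorem markerPos_pow_le (hSH : StandingHyp) (hm : 2 ≤ m) (e : ℕ) :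
    markerPos (gapLen m) ((m + 1) ^ e) ≤ (m + e + 1) ^ (e + 1) := by
  induction e generalizing m with
  | zero =>
    rw [pow_zero, markerPos_of_le (by omega) (by omega)]
    simp
  | succ e ih =>
    have h1 := markerPos_pow_succ (m := m) (by omega) e
    have h2 := ih hm
    have h3 : cutPos m (e + 1) ≤ (m + e + 2) ^ (e + 1) := by
      rcases e with _ | e
      · exact (cutPos_one_le (by omega)).trans (Nat.one_le_pow _ _ (by omega))
      · have h4 := two_pow_le_cutCount (m := m + 1) (by omega) (hSH (m + 1) (by omega)).2 e
        have h5 : e + 1 < 2 ^ (e + 1) := Nat.lt_two_pow_self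
        have h6 := le_cutCount (m := m + 1) (by omega) (hSH (m + 1) (by omega)).2 e
        have h7 : 2 ^ e * 2 ≤ 2 ^ e * (m + 1 - 1) := Nat.mul_le_mul_left _ (by omega)
        refine (cutPos_lt_markerPos_pow (e := e + 1) (by omega)
          (by rw [pow_succ] at h5; omega)).le.trans ?_
        refine (ih (m := m + 1) (by omega)).trans (le_of_eq ?_)
        congr 1; omega
    have h8 : (m + e + 1) ^ (e + 1) ≤ (m + e + 2) ^ (e + 1) := Nat.pow_le_pow_left (by omega) _
    have h9 := Nat.mul_le_mul_left (m + 1) (h2.trans h8)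
    calc _ ≤ (m + 1) * (m + e + 2) ^ (e + 1) + (m + e + 2) ^ (e + 1) := by omega
      _ = (m + 2) * (m + e + 2) ^ (e + 1) := by ring
      _ ≤ (m + e + 2) * (m + e + 2) ^ (e + 1) := Nat.mul_le_mul_right _ (by omega)
      _ = _ := by rw [← add_assoc m, pow_succ _ (e + 1), mul_comm]

theorem cutPos_le (hSH : StandingHyp) (hm : 1 ≤ m) {r l : ℕ} (hr : r ≤ 2 ^ (l + 1)) :
    cutPos m r ≤ (m + l + 4) ^ (l + 3) := by
  have h1 := two_pow_le_cutCount (m := m + 1) (by omega) (hSH (m + 1) (by omega)).2 (l + 1)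
  refine (cutPos_lt_markerPos_pow hm (hr.trans h1)).le.trans
    ((markerPos_pow_le hSH (by omega) _).trans (le_of_eq ?_))
  congr 1; omega

theorem cutPos_le_pow (hSH : StandingHyp) (hm : 1 ≤ m) {θ : ℝ} (hθ : 1 < θ) :
    ∀ᶠ r in atTop, (cutPos m r : ℝ) ≤ θ ^ r := by
  have hlog : 0 < Real.log θ := Real.log_pos hθ
  have lim : Tendsto (fun l : ℕ => ((l + (m + 4) : ℕ) : ℝ) ^ 2 / 2 ^ (l + (m + 4))) atTop
      (nhds 0) :=
    (tendsto_pow_const_div_const_pow_of_one_lt 2 (one_lt_two (α := ℝ))).comp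
      (tendsto_add_atTop_nat (m + 4))
  have ev := lim.eventually (gt_mem_nhds (show 0 < Real.log θ / 2 ^ (m + 4) by positivity))
  have tlog : Tendsto (fun r => Nat.log 2 r) atTop atTop :=
    tendsto_atTop_mono' _ (Eventually.of_forall fun r => le_rfl) (by
      refine tendsto_atTop.2 fun b => ?_
      filter_upwards [eventually_ge_atTop (2 ^ b)] with r hr
      exact Nat.le_log_of_pow_le (by omega) hr)
  filter_upwards [tlog.eventually ev, eventually_ge_atTop 1] with r hr hr1
  set l := Nat.log 2 r with hl
  have h1 : cutPos m r ≤ (m + l + 4) ^ (l + 3) :=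
    cutPos_le hSH hm (Nat.lt_pow_succ_log_self (by omega) r).le
  have h2 : 2 ^ l ≤ r := Nat.pow_log_le_self 2 (by omega)
  have hA : (0 : ℝ) < ((l + (m + 4) : ℕ) : ℝ) := by exact_mod_cast (show 0 < l + (m + 4) by omega)
  have h3 : ((l + (m + 4) : ℕ) : ℝ) ^ 2 ≤ Real.log θ * 2 ^ l := by
    rw [pow_add, div_lt_div_iff₀ (by positivity) (by positivity)] at hr
    have : (0 : ℝ) < 2 ^ (m + 4) := by positivity
    nlinarith
  have h4 : ((l + 3 : ℕ) : ℝ) * Real.log ((l + (m + 4) : ℕ) : ℝ) ≤ ((l + (m + 4) : ℕ) : ℝ) ^ 2 := by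
    rw [sq]
    have := Real.log_le_sub_one_of_pos hA
    have h5 : ((l + 3 : ℕ) : ℝ) ≤ ((l + (m + 4) : ℕ) : ℝ) := by exact_mod_cast (by omega)
    refine mul_le_mul h5 (by linarith) (Real.log_natCast_nonneg _) hA.le
  have h6 : Real.log θ * 2 ^ l ≤ Real.log θ * r := by
    have : ((2 ^ l : ℕ) : ℝ) ≤ r := by exact_mod_cast h2
    push_cast at this
    exact mul_le_mul_of_nonneg_left this hlog.le
  calc (cutPos m r : ℝ) ≤ (((l + (m + 4) : ℕ) : ℝ)) ^ (l + 3) := by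
        have h7 : cutPos m r ≤ (l + (m + 4)) ^ (l + 3) := by
          rwa [show l + (m + 4) = m + l + 4 by omega]
        exact_mod_cast h7
    _ = Real.exp (((l + 3 : ℕ) : ℝ) * Real.log ((l + (m + 4) : ℕ) : ℝ)) := by
        rw [Real.exp_nat_mul, Real.exp_log hA]
    _ ≤ Real.exp (r * Real.log θ) := Real.exp_le_exp.2 (by linarith)
    _ = θ ^ r := by rw [Real.exp_nat_mul, Real.exp_log (by linarith)]

end

theorem cutPos_block (hSH : StandingHyp) {m : ℕ} (hm : 1 ≤ m) (n₀ : ℕ) :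
    ∃ B n N, n₀ ≤ n ∧ (m + 1) * n ≤ N ∧ B < cutPos m (n + 1) ∧
      (∀ r, 1 ≤ r → r + n < N → cutPos m (r + n) = cutPos m r + B) ∧
      (∀ r, r < N → cutPos m r < (m + 1) * B) ∧ (∀ r, N ≤ r → (m + 2) * B ≤ cutPos m r) := by
  have hK := (hSH m hm).2
  have hK' := (hSH (m + 1) (by omega)).2
  obtain ⟨e, he, hlift⟩ := exists_liftable hK' (n₀ + 1)
  have hB : 0 < markerPos (gapLen (m + 1)) ((m + 2) ^ e) :=
    markerPos_strictMono (gapLen (m + 1)) (show 0 < (m + 2) ^ e by positivity)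
  obtain ⟨n, N, h1, h2, h3, h4, h5⟩ := exists_nth_block (c := m + 1)
    (κ := fun k => curl (gPrefix (m + 1) k) < m + 1)
    (hK.mono fun k hk => Nat.lt_succ_of_le hk)
    (by rw [curl_gPrefix_zero]; omega) hB (by omega)
    (fun x hx hxB => curl_lt_add_markerPos_iff (by omega) hK' hlift hx hxB)
    (fun k hk1 hk2 => not_lt.2 (le_curl_of_mem_Ico (by omega) hK' hk1 hk2))
  rw [← cutPos_eq_nth] at h2 h3 h4 h5
  refine ⟨_, n, N, ?_, h1, ?_, h3, h4, h5⟩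
  · obtain ⟨e, rfl⟩ : ∃ d, e = d + 1 := ⟨e - 1, by omega⟩
    have h6 := (h2 _).2 (cutPos_lt_markerPos_pow hm (le_refl (cutCount (m + 1) (e + 1)))).le
    have h7 := two_pow_le_cutCount (m := m + 1) (by omega) hK' e
    have h8 : e < 2 ^ e := Nat.lt_two_pow_self
    omega
  · have := h2 (n + 1)
    omega

section

variable {a : ℕ → ℝ} {b B : ℝ} {n N : ℕ}

/-- Multiplying a power series in `1 / b` by `1 - b ^ (-n)` when the coefficients are periodic
with period `n` up to a constant. -/
theorem hasSum_block (hb : 1 < b) (ha0 : a 0 = 0) (hs : Summable fun r => a r / b ^ r) (hnN : n < N)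
    (hsh : ∀ r, 1 ≤ r → r + n < N → a (r + n) = a r + B) :
    HasSum (fun j => (a (j + N) - a (j + N - n) - B) / b ^ (j + N))
      ((∑' r, a r / b ^ r) * (1 - (b ^ n)⁻¹) - ∑ r ∈ Finset.range (n + 1), a r / b ^ r -
        B / (b ^ n * (b - 1))) := by
  obtain ⟨d, rfl⟩ : ∃ d, N = d + n + 1 := ⟨N - n - 1, by omega⟩
  have hb0 : (0 : ℝ) < b := by linarith
  have h2 := (hasSum_nat_add_iff' (n + 1)).2 hs.hasSum
  have h3 := ((hasSum_nat_add_iff' 1).2 hs.hasSum).mul_left (b ^ n)⁻¹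
  have h4 := (hasSum_geometric_of_lt_one (inv_nonneg.2 hb0.le) (inv_lt_one_of_one_lt₀ hb)).mul_left
    (B / b ^ (n + 1))
  have h5 := (hasSum_nat_add_iff' d).2 ((h2.sub h3).sub h4)
  have key : ∀ j, a (j + (n + 1)) / b ^ (j + (n + 1)) - (b ^ n)⁻¹ * (a (j + 1) / b ^ (j + 1)) -
      B / b ^ (n + 1) * b⁻¹ ^ j = (a (j + n + 1) - a (j + 1) - B) / b ^ (j + n + 1) := by
    intro j
    rw [inv_pow, ← add_assoc]
    field_simp
    ring
  simp only [key] at h5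
  convert h5 using 1
  · rfl
  · funext j
    rw [show j + (d + n + 1) - n = j + d + 1 by omega, ← add_assoc, ← add_assoc]
  · rw [Finset.sum_eq_zero (s := Finset.range d)]
    · have : b - 1 ≠ 0 := by linarith
      simp only [Finset.range_one, Finset.sum_singleton, ha0, zero_div, sub_zero]
      have e : B / (b ^ n * (b - 1)) = B / b ^ (n + 1) * (1 - b⁻¹)⁻¹ := by
        rw [show 1 - b⁻¹ = (b - 1) / b by field_simp]
        field_simp
        ring
      rw [e]
      ring
    · intro j hj
      rw [Finset.mem_range] at hj
      rw [show j + n + 1 = j + 1 + n by omega, hsh (j + 1) (by omega) (by omega)]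
      simp

theorem pos_of_hasSum_block {E : ℝ} (hb : 2 ≤ b) (hB : 0 ≤ B) (hn : 1 ≤ n) (hBn : 2 * B < b ^ n)
    (h1 : ∀ j < n, 1 ≤ a (j + N) - a (j + N - n) - B) (ha : Monotone a)
    (hE : HasSum (fun j => (a (j + N) - a (j + N - n) - B) / b ^ (j + N)) E) : 0 < E := by
  have hb0 : (0 : ℝ) < b := by linarith
  have h2 := (hasSum_nat_add_iff' n).2 hE
  have h3 := (hasSum_geometric_of_lt_one (inv_nonneg.2 hb0.le)
    (inv_lt_one_of_one_lt₀ (by linarith : 1 < b))).mul_left (-B / b ^ (n + N))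
  have h4 := hasSum_le (fun j => ?_) h3 h2
  · have h5 : 1 / b ^ N ≤
        ∑ j ∈ Finset.range n, (a (j + N) - a (j + N - n) - B) / b ^ (j + N) := by
      refine le_trans ?_ (Finset.single_le_sum (f := fun j => (a (j + N) - a (j + N - n) - B) /
        b ^ (j + N)) (fun j hj => ?_) (Finset.mem_range.2 hn))
      · have := h1 0 hn
        rw [zero_add] at this ⊢
        gcongr
      · have := h1 j (Finset.mem_range.1 hj)
        exact div_nonneg (by linarith) (by positivity)
    have h6 : (1 - b⁻¹)⁻¹ ≤ 2 := by
      have : b⁻¹ ≤ 2⁻¹ := inv_anti₀ (by norm_num) hb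
      rw [inv_le_comm₀ (by linarith) (by norm_num)]
      linarith
    have h7 : B / b ^ (n + N) * (1 - b⁻¹)⁻¹ < 1 / b ^ N := by
      calc B / b ^ (n + N) * (1 - b⁻¹)⁻¹ ≤ B / b ^ (n + N) * 2 := by gcongr
        _ = (2 * B) / b ^ n / b ^ N := by rw [pow_add]; field_simp
        _ < 1 / b ^ N := by
          gcongr
          rwa [div_lt_one (by positivity)]
    rw [neg_div, neg_mul] at h4
    linarith
  · have : a (j + n + N - n) ≤ a (j + n + N) := ha (by omega)
    rw [inv_pow, ← div_eq_mul_inv, div_div, ← pow_add, show n + N + j = j + n + N by omega]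
    gcongr
    linarith

theorem le_of_hasSum_block {E θ : ℝ} (hb : 0 < b) (hB : 0 ≤ B) (ha : ∀ r, 0 ≤ a r) (hθ0 : 0 ≤ θ)
    (hθ : θ < b) (hN : ∀ r, N ≤ r → a r ≤ θ ^ r)
    (hE : HasSum (fun j => (a (j + N) - a (j + N - n) - B) / b ^ (j + N)) E) :
    E ≤ (θ / b) ^ N * (1 - θ / b)⁻¹ := by
  have h := (hasSum_geometric_of_lt_one (div_nonneg hθ0 hb.le)
    ((div_lt_one hb).2 hθ)).mul_left ((θ / b) ^ N)
  refine hasSum_le (fun j => ?_) hE h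
  rw [← pow_add, add_comm N j, div_pow]
  have h1 := hN (j + N) (by omega)
  have h2 := ha (j + N - n)
  gcongr
  linarith

end

theorem summable_cutPos (hSH : StandingHyp) {m : ℕ} (hm : 1 ≤ m) :
    Summable fun r => (cutPos m r : ℝ) / ((m : ℝ) + 1) ^ r := by
  have hm' : (1 : ℝ) ≤ m := by exact_mod_cast hm
  have hg : Summable fun r : ℕ => ((3 / 2 : ℝ) / ((m : ℝ) + 1)) ^ r :=
    summable_geometric_of_lt_one (by positivity) (by rw [div_lt_one (by positivity)]; linarith)
  refine Summable.of_norm_bounded_eventually_nat hg ?_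
  filter_upwards [cutPos_le_pow hSH hm (show (1 : ℝ) < 3 / 2 by norm_num)] with r hr
  rw [Real.norm_of_nonneg (by positivity), div_pow]
  gcongr

theorem eq_tsum_cutPos (hSH : StandingHyp) {m : ℕ} (hm : 1 ≤ m) {ε : ℝ}
    (hε : Tendsto (fun t : ℕ => (beta m t : ℝ) / ((m : ℝ) + 1) ^ (t - 1)) atTop (nhds ε)) :
    ε = 1 + (m : ℝ) / (m + 1) * ∑' r, (cutPos m r : ℝ) / ((m : ℝ) + 1) ^ r := by
  have hs := summable_cutPos hSH hm
  have h1 : Tendsto (fun r => (beta m (r + 1) : ℝ) / ((m : ℝ) + 1) ^ r -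
      (cutPos m r : ℝ) / ((m : ℝ) + 1) ^ r) atTop (nhds ε) := by
    have := (hε.comp (tendsto_add_atTop_nat 1)).sub hs.tendsto_atTop_zero
    simpa using this
  have h2 := (hs.hasSum.tendsto_sum_nat.const_mul ((m : ℝ) / (m + 1))).const_add 1
  refine tendsto_nhds_unique h1 (h2.congr fun r => ?_)
  have hβ : ∀ r, beta m (r + 1) = markerPos (gapLen m) ((m + 1) ^ r) := fun r =>
    piLen_eq_markerPos hm (hSH m hm).2 (hSH m hm).1 _
  simp only [hβ]
  induction r with
  | zero =>
    rw [pow_zero, markerPos_of_le hm hm, cutPos_zero hm]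
    simp
  | succ r ih =>
    have e : ((markerPos (gapLen m) ((m + 1) ^ (r + 1)) : ℕ) : ℝ) =
        (m + 1) * (markerPos (gapLen m) ((m + 1) ^ r) : ℕ) + cutPos m (r + 1) - cutPos m r := by
      rw [eq_sub_iff_add_eq]
      exact_mod_cast markerPos_pow_succ hm r
    rw [Finset.sum_range_succ, mul_add, ← add_assoc, ih, e]
    field_simp
    ring

theorem exists_base_lt {b κ : ℝ} (hb : 1 < b) (hκ0 : 0 ≤ κ) (hκ : κ < b) :
    ∃ θ : ℝ, 1 < θ ∧ θ < b ∧ b ^ κ * (θ / b) ^ b < 1 := by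
  have hb0 : 0 < b := by linarith
  have h1 : κ / b < 1 := (div_lt_one hb0).2 hκ
  have h2 : 0 ≤ κ / b := by positivity
  refine ⟨b ^ ((1 - κ / b) / 2), Real.one_lt_rpow hb (by linarith), ?_, ?_⟩
  · exact Real.rpow_lt_self_of_one_lt hb (by linarith)
  · rw [← Real.rpow_sub_one hb0.ne', ← Real.rpow_mul hb0.le, ← Real.rpow_add hb0]
    refine Real.rpow_lt_one_of_one_lt_of_neg hb ?_
    have : κ / b * b = κ := div_mul_cancel₀ _ hb0.ne'
    linarith

theorem exists_rat_approx (hSH : StandingHyp) {m : ℕ} (hm : 1 ≤ m) {ε : ℝ}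
    (hε : Tendsto (fun t : ℕ => (beta m t : ℝ) / ((m : ℝ) + 1) ^ (t - 1)) atTop (nhds ε))
    {κ : ℝ} (hκ0 : 0 ≤ κ) (hκ : κ < (m : ℝ) + 1) (n₀ : ℕ) :
    ∃ p q : ℤ, 1 ≤ q ∧ (n₀ : ℤ) ≤ q ∧ 0 < ε - (p : ℝ) / (q : ℝ) ∧
      ε - (p : ℝ) / (q : ℝ) < 1 / (q : ℝ) ^ κ := by
  have hm' : (1 : ℝ) ≤ m := by exact_mod_cast hm
  have hε' := eq_tsum_cutPos hSH hm hε
  have hs := summable_cutPos hSH hm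
  set b : ℝ := (m : ℝ) + 1 with hbdef
  have hb : 2 ≤ b := by linarith
  have hb0 : 0 < b := by linarith
  obtain ⟨θ, hθ1, hθb, hθκ⟩ := exists_base_lt (by linarith) hκ0 hκ
  have hθ0 : 0 < θ := by linarith
  have hx1 : θ / b < 1 := (div_lt_one hb0).2 hθb
  have hx0 : 0 < θ / b := by positivity
  set C := (1 - θ / b)⁻¹ with hC
  have hC0 : 0 < C := inv_pos.2 (by linarith)
  have ev1 : ∀ᶠ n : ℕ in atTop, 2 * θ * (θ / b) ^ n < 1 := by
    have := (tendsto_pow_atTop_nhds_zero_of_lt_one hx0.le hx1).const_mul (2 * θ)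
    rw [mul_zero] at this
    exact this.eventually_lt_const one_pos
  have ev2 : ∀ᶠ n : ℕ in atTop, 2 * C * b ^ κ * (b ^ κ * (θ / b) ^ b) ^ n < 1 := by
    have := (tendsto_pow_atTop_nhds_zero_of_lt_one (by positivity) hθκ).const_mul (2 * C * b ^ κ)
    rw [mul_zero] at this
    exact this.eventually_lt_const one_pos
  obtain ⟨n₁, hn₁⟩ := eventually_atTop.1 (((cutPos_le_pow hSH hm hθ1).and ev1).and
    (ev2.and (eventually_ge_atTop (max n₀ 1))))
  obtain ⟨B, n, N, hn, hnN, hB, hsh, hlt, hge⟩ := cutPos_block hSH hm n₁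
  obtain ⟨⟨-, hb1⟩, hb2, hn0⟩ := hn₁ n hn
  have hn1 : 1 ≤ n := (le_max_right _ _).trans hn0
  have hnN' : n < N := by nlinarith
  have hE := hasSum_block (a := fun r => (cutPos m r : ℝ)) (B := B) (b := b) (by linarith)
    (by simp [cutPos_zero hm]) hs hnN' (fun r h1 h2 => by exact_mod_cast hsh r h1 h2)
  set s := ∑' r, (cutPos m r : ℝ) / b ^ r
  set E := s * (1 - (b ^ n)⁻¹) - ∑ r ∈ Finset.range (n + 1), (cutPos m r : ℝ) / b ^ r -
    B / (b ^ n * (b - 1)) with hEdef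
  have hBn : 2 * (B : ℝ) < b ^ n := by
    have h1 : (B : ℝ) < θ ^ (n + 1) :=
      lt_of_lt_of_le (by exact_mod_cast hB) (hn₁ (n + 1) (by omega)).1.1
    have h2 : 2 * θ * θ ^ n < b ^ n := by
      rwa [div_pow, ← mul_div_assoc, div_lt_one (by positivity)] at hb1
    rw [pow_succ] at h1
    linarith
  have hE0 : 0 < E := by
    refine pos_of_hasSum_block (a := fun r => (cutPos m r : ℝ)) hb B.cast_nonneg hn1 hBn
      (fun j hj => ?_) (Nat.mono_cast.comp (cutPos_strictMono (hSH m hm).2).monotone) hE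
    have h1 := hge (j + N) (by omega)
    have h2 := hlt (j + N - n) (by omega)
    have h3 : 1 + cutPos m (j + N - n) + B ≤ cutPos m (j + N) := by nlinarith
    have h4 : (1 : ℝ) + cutPos m (j + N - n) + B ≤ cutPos m (j + N) := by exact_mod_cast h3
    linarith
  have hE1 : E ≤ (θ / b) ^ N * C :=
    le_of_hasSum_block hb0 B.cast_nonneg (fun r => Nat.cast_nonneg _) hθ0.le hθb
      (fun r hr => (hn₁ r (by omega)).1.1) hE
  have hbn : 2 ≤ b ^ n := hb.trans (le_self_pow₀ (by linarith) (by omega))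
  have hq : (((m + 1) * ((m + 1) ^ n - 1) : ℤ) : ℝ) = b * (b ^ n - 1) := by
    push_cast; ring
  obtain ⟨p, hdiff⟩ : ∃ p : ℤ, ε - (p : ℝ) / (((m + 1) * ((m + 1) ^ n - 1) : ℤ) : ℝ) =
      m / b * (E / (1 - (b ^ n)⁻¹)) := by
    refine ⟨(m + 1) * ((m + 1) ^ n - 1) +
      m * ∑ r ∈ Finset.range (n + 1), (cutPos m r : ℤ) * (m + 1) ^ (n - r) + B, ?_⟩
    have hsum : ∑ r ∈ Finset.range (n + 1), (cutPos m r : ℝ) * b ^ (n - r) =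
        b ^ n * ∑ r ∈ Finset.range (n + 1), (cutPos m r : ℝ) / b ^ r := by
      rw [Finset.mul_sum]
      refine Finset.sum_congr rfl fun r hr => ?_
      rw [Finset.mem_range] at hr
      rw [pow_sub₀ _ hb0.ne' (by omega)]
      field_simp
    have hp : (((m + 1) * ((m + 1) ^ n - 1) +
        m * ∑ r ∈ Finset.range (n + 1), (cutPos m r : ℤ) * (m + 1) ^ (n - r) + B : ℤ) : ℝ) =
        b * (b ^ n - 1) +
          m * (b ^ n * ∑ r ∈ Finset.range (n + 1), (cutPos m r : ℝ) / b ^ r) + B := by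
      rw [← hsum]
      push_cast
      rfl
    rw [hp, hq, hε', hEdef]
    have h1 : b ^ n - 1 ≠ 0 := by linarith
    have h2 : (m : ℝ) = b - 1 := by rw [hbdef]; ring
    have h3 : b - 1 ≠ 0 := by linarith
    rw [h2, show 1 - (b ^ n)⁻¹ = (b ^ n - 1) / b ^ n by field_simp]
    field_simp
    ring
  have hinv : (b ^ n)⁻¹ ≤ 2⁻¹ := inv_anti₀ (by norm_num) hbn
  have hnq : (n : ℤ) ≤ (m + 1) * ((m + 1) ^ n - 1) := by
    have h1 : n + 1 ≤ (m + 1) ^ n := Nat.lt_pow_self (by omega)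
    have h2 : (n : ℤ) + 1 ≤ ((m : ℤ) + 1) ^ n := by exact_mod_cast h1
    nlinarith
  refine ⟨p, (m + 1) * ((m + 1) ^ n - 1), by omega, by omega, ?_⟩
  rw [hdiff]
  constructor
  · have : 0 < 1 - (b ^ n)⁻¹ := by linarith
    positivity
  · have hmb : (m : ℝ) / b ≤ 1 := by rw [div_le_one hb0]; linarith
    have h1 : E / (1 - (b ^ n)⁻¹) ≤ E * 2 := by
      rw [div_le_iff₀ (by linarith)]
      nlinarith
    have h2 : (m : ℝ) / b * (E / (1 - (b ^ n)⁻¹)) ≤ 2 * C * (θ / b) ^ N := by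
      refine (mul_le_of_le_one_left (div_nonneg hE0.le (by linarith)) hmb).trans ?_
      linarith
    have h3 : (θ / b) ^ N ≤ (θ / b) ^ ((m + 1) * n) := pow_le_pow_of_le_one hx0.le hx1.le hnN
    have h4 : (θ / b) ^ ((m + 1) * n) = ((θ / b) ^ b) ^ n := by
      rw [pow_mul, hbdef, ← Real.rpow_natCast _ (m + 1)]
      push_cast
      rfl
    have hqle : (b * (b ^ n - 1)) ^ κ ≤ b ^ κ * (b ^ κ) ^ n := by
      rw [← pow_succ', ← Real.rpow_mul_natCast hb0.le, mul_comm κ, Real.rpow_natCast_mul hb0.le]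
      refine Real.rpow_le_rpow (by nlinarith) ?_ hκ0
      rw [pow_succ']
      nlinarith
    have hq0 : 0 < b * (b ^ n - 1) := mul_pos hb0 (by linarith)
    rw [hq, lt_div_iff₀ (Real.rpow_pos_of_pos hq0 κ)]
    calc m / b * (E / (1 - (b ^ n)⁻¹)) * (b * (b ^ n - 1)) ^ κ
        ≤ 2 * C * ((θ / b) ^ b) ^ n * (b ^ κ * (b ^ κ) ^ n) := by
          rw [← h4]
          exact mul_le_mul (h2.trans (by gcongr)) hqle (by positivity) (by positivity)
      _ = 2 * C * b ^ κ * (b ^ κ * (θ / b) ^ b) ^ n := by rw [mul_pow]; ring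
      _ < 1 := hb2

/-- Theorem `epsilonm transcendental`. For every `m ≥ 1` and every real
`κ < m+1` there are infinitely many `(p,q)`, `q > 0`, with `0 < |ε_m − p/q| < 1/q^κ`;
in particular `μ(ε_m) ≥ m+1`. -/
theorem statement15 (hSH : StandingHyp) (m : ℕ) (hm : 1 ≤ m) (ε : ℝ)
    (hε : Tendsto (fun t : ℕ => (beta m t : ℝ) / ((m : ℝ) + 1) ^ (t - 1)) atTop (nhds ε)) :
    ∀ κ : ℝ, κ < (m : ℝ) + 1 →
      {pq : ℤ × ℤ | 0 < pq.2 ∧ 0 < |ε - (pq.1 : ℝ) / (pq.2 : ℝ)| ∧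
        |ε - (pq.1 : ℝ) / (pq.2 : ℝ)| < 1 / (pq.2 : ℝ) ^ κ}.Infinite := by
  intro κ hκ
  refine Set.Infinite.of_image Prod.snd (Set.infinite_of_not_bddAbove ?_)
  rintro ⟨M, hM⟩
  obtain ⟨p, q, hq1, hq, h0, h1⟩ := exists_rat_approx hSH hm hε (le_max_right κ 0)
    (max_lt hκ (by positivity)) (M.toNat + 1)
  refine absurd (hM ⟨(p, q), ⟨by omega, ?_, ?_⟩, rfl⟩) (by push_cast at hq; omega)
  · exact abs_pos.2 h0.ne'
  · rw [abs_of_pos h0]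
    refine h1.trans_le ?_
    have : (1 : ℝ) ≤ q := by exact_mod_cast hq1
    gcongr
    exact le_max_left _ _
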